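/- arXiv:1206.2272 — 2 statements merged into one kernel-verified Lean document; each statement's English description precedes it below -/
import Mathlib

section
/- Let Ω ⊂ ℝ² be a compact convex body with C¹ arclength boundary parametrization c of period L, and suppose A_{1/3}(s) = A_{1/3}(0) for all s, where A_{1/3}(s) = (1/2)·∫_s^{s+L/3} det(c(t) − c(s), c'(t)) dt. Then the boundary of Ω is a circle: there exist x₀ ∈ ℝ² and r > 0 with ‖c(s) − x₀‖ = r for all s. -/
open Real InnerProductGeometry

/-- The plane `ℝ²`. -/
abbrev Plane := EuclideanSpace ℝ (Fin 2)

/-- `c : ℝ → ℝ²` is a `C¹` arclength parametrization, of period `L`, of the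
boundary of the plane body `Ω`. -/
structure IsArclengthParam (Ω : Set Plane) (c : ℝ → Plane) (L : ℝ) : Prop where
  hL : 0 < L
  contDiff : ContDiff ℝ 1 c
  unitSpeed : ∀ s, ‖deriv c s‖ = 1
  periodic : Function.Periodic c L
  injOn : Set.InjOn c (Set.Ico 0 L)
  range_eq : Set.range c = frontier Ω

/-- The determinant `det(u,v) = u₁ v₂ − u₂ v₁` of a pair of plane vectors. -/
noncomputable def det2 (u v : Plane) : ℝ := u 0 * v 1 - u 1 * v 0

/-- The area `A_δ(s)` cut off by the boundary arc from `c s` to `c (s + δL)`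
and its chord. -/
noncomputable def cutArea (c : ℝ → Plane) (L δ s : ℝ) : ℝ :=
  (1 / 2) * ∫ t in s..(s + δ * L), det2 (c t - c s) (deriv c t)

open Filter Topology

/-- The scalar product of two plane vectors, in coordinates. -/
noncomputable def dot2 (u v : Plane) : ℝ := u 0 * v 0 + u 1 * v 1

lemma plane_ext {u v : Plane} (h₀ : u 0 = v 0) (h₁ : u 1 = v 1) : u = v := by
  ext i
  fin_cases i
  exacts [h₀, h₁]

lemma norm_sq_eq_dot2 (u : Plane) : ‖u‖ ^ 2 = dot2 u u := by
  rw [EuclideanSpace.norm_sq_eq, Fin.sum_univ_two, dot2]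
  simp only [Real.norm_eq_abs, sq_abs]
  ring

lemma HasDerivAt.plane_apply {f : ℝ → Plane} {f' : Plane} {s : ℝ} (h : HasDerivAt f f' s)
    (i : Fin 2) : HasDerivAt (fun t => f t i) (f' i) s :=
  (EuclideanSpace.proj (𝕜 := ℝ) i).hasFDerivAt.comp_hasDerivAt s h

lemma HasDerivAt.det2 {f g : ℝ → Plane} {f' g' : Plane} {s : ℝ} (hf : HasDerivAt f f' s)
    (hg : HasDerivAt g g' s) :
    HasDerivAt (fun t => det2 (f t) (g t)) (det2 f' (g s) + det2 (f s) g') s := by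
  have h := ((hf.plane_apply 0).mul (hg.plane_apply 1)).sub
    ((hf.plane_apply 1).mul (hg.plane_apply 0))
  refine h.congr_deriv ?_
  simp only [_root_.det2]
  ring

lemma HasDerivAt.dot2 {f g : ℝ → Plane} {f' g' : Plane} {s : ℝ} (hf : HasDerivAt f f' s)
    (hg : HasDerivAt g g' s) :
    HasDerivAt (fun t => dot2 (f t) (g t)) (dot2 f' (g s) + dot2 (f s) g') s := by
  have h := ((hf.plane_apply 0).mul (hg.plane_apply 0)).add
    ((hf.plane_apply 1).mul (hg.plane_apply 1))
  refine h.congr_deriv ?_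
  simp only [_root_.dot2]
  ring

lemma Continuous.det2 {α : Type*} [TopologicalSpace α] {f g : α → Plane} (hf : Continuous f)
    (hg : Continuous g) : Continuous fun t => det2 (f t) (g t) := by
  unfold _root_.det2
  fun_prop

lemma Continuous.dot2 {α : Type*} [TopologicalSpace α] {f g : α → Plane} (hf : Continuous f)
    (hg : Continuous g) : Continuous fun t => dot2 (f t) (g t) := by
  unfold _root_.dot2
  fun_prop

lemma eq_smul_of_det2_eq_zero {u v : Plane} (hu : dot2 u u ≠ 0) (h : det2 u v = 0) :
    v = (dot2 u v / dot2 u u) • u := by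
  apply plane_ext <;> simp only [PiLp.smul_apply, smul_eq_mul] <;>
    rw [div_mul_eq_mul_div, eq_div_iff hu] <;> simp only [det2, dot2] at h ⊢
  · linear_combination (-u 1) * h
  · linear_combination (u 0) * h

lemma dot2_self_eq_zero {u : Plane} (h : dot2 u u = 0) : u = 0 := by
  have : ‖u‖ ^ 2 = 0 := by rw [norm_sq_eq_dot2, h]
  simpa using this

lemma eq_of_det2_eq_zero_of_dot2_pos {u v : Plane} (hu : dot2 u u = 1) (hv : dot2 v v = 1)
    (h : det2 u v = 0) (hpos : 0 < dot2 u v) : v = u := by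
  have h1 : dot2 u v ^ 2 = 1 := by
    have : dot2 u v ^ 2 + det2 u v ^ 2 = dot2 u u * dot2 v v := by
      simp only [dot2, det2]; ring
    rw [h, hu, hv] at this
    linarith
  have h2 : dot2 u v = 1 := by nlinarith
  have := eq_smul_of_det2_eq_zero (by rw [hu]; exact one_ne_zero) h
  rwa [h2, hu, div_one, one_smul] at this

/-- A closed curve of unit speed, simple modulo its period, that lies on one side of each of its
tangent lines; the sign `ε` records the orientation. -/
structure IsConvexCurve (c T : ℝ → Plane) (L ε : ℝ) : Prop where
  period_pos : 0 < L
  hasDerivAt : ∀ s, HasDerivAt c (T s) s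
  continuous_tangent : Continuous T
  unit : ∀ s, dot2 (T s) (T s) = 1
  periodic : ∀ s, c (s + L) = c s
  periodic_tangent : ∀ s, T (s + L) = T s
  inj : ∀ s t, c s = c t → ∃ k : ℤ, t = s + k * L
  sign_sq : ε * ε = 1
  support : ∀ s t, 0 ≤ ε * det2 (T s) (c t - c s)

namespace IsConvexCurve

variable {c T : ℝ → Plane} {L ε : ℝ}

lemma continuous (h : IsConvexCurve c T L ε) : Continuous c :=
  continuous_iff_continuousAt.2 fun s => (h.hasDerivAt s).continuousAt

lemma deriv_eq (h : IsConvexCurve c T L ε) : deriv c = T :=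
  funext fun s => (h.hasDerivAt s).deriv

lemma ne_of_lt (h : IsConvexCurve c T L ε) {s t : ℝ} (hst : s < t) (htL : t < s + L) :
    c s ≠ c t := by
  intro heq
  obtain ⟨k, hk⟩ := h.inj s t heq
  have hL := h.period_pos
  have h1 : (0 : ℝ) < k := by
    by_contra hk'
    nlinarith
  have h2 : (k : ℝ) < 1 := by
    by_contra hk'
    nlinarith
  have h3 : 0 < k := by exact_mod_cast h1
  have h4 : k < 1 := by exact_mod_cast h2
  omega

lemma eq_add_smul_of_tangent_eq (h : IsConvexCurve c T L ε) {a b : ℝ} {e : Plane}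
    (hT : ∀ t ∈ Set.Ico a b, T t = e) : ∀ t ∈ Set.Icc a b, c t = c a + (t - a) • e := by
  have key := constant_of_has_deriv_right_zero (f := fun t => c t - t • e) (a := a) (b := b)
    (by have := h.continuous; fun_prop) (fun t ht => by
      have h1 := (h.hasDerivAt t).sub ((hasDerivAt_id t).smul_const e)
      rw [hT t ht, one_smul, sub_self] at h1
      exact h1.hasDerivWithinAt)
  intro t ht
  have := key t ht
  rw [sub_eq_iff_eq_add] at this
  rw [this, sub_smul]
  abel

/-- If the tangent ray at `c a` meets the curve again at distance `l`, then the curve follows this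
ray up to that point. -/
lemma eq_add_smul_of_mem_tangent (h : IsConvexCurve c T L ε) {a b l : ℝ}
    (hb : c b = c a + l • T a) :
    ∀ t ∈ Set.Icc a (a + l), T t = T a ∧ c t = c a + (t - a) • T a := by
  have hc := h.continuous
  have hTc := h.continuous_tangent
  set S : Set ℝ := {t | T t = T a ∧ c t = c a + (t - a) • T a}
  have hclosed : IsClosed S :=
    (isClosed_eq hTc continuous_const).inter (isClosed_eq hc (by fun_prop))
  refine (hclosed.inter isClosed_Icc).Icc_subset_of_forall_mem_nhdsWithin ⟨rfl, by simp⟩ ?_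
  rintro t ⟨⟨hTt, hct⟩, hat, htl⟩
  have hunit := h.unit a
  have hdot : ∀ᶠ r in 𝓝 t, 0 < dot2 (T a) (T r) :=
    ((continuous_const.dot2 hTc).tendsto t).eventually_const_lt (by rw [hTt, hunit]; norm_num)
  have hbefore : ∀ᶠ r in 𝓝 t, dot2 (T a) (c r - c a) < l := by
    refine ((continuous_const.dot2 (hc.sub continuous_const)).tendsto t).eventually_lt_const ?_
    have : dot2 (T a) (c t - c a) = (t - a) * dot2 (T a) (T a) := by
      rw [hct]
      simp only [dot2, PiLp.sub_apply, PiLp.add_apply, PiLp.smul_apply, smul_eq_mul]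
      ring
    change dot2 (T a) (c t - c a) < l
    rw [this, hunit]
    linarith
  obtain ⟨d, hd, hball⟩ := Metric.eventually_nhds_iff.1 (hdot.and hbefore)
  have hnear : ∀ r ∈ Set.Ico t (t + d), 0 < dot2 (T a) (T r) ∧ dot2 (T a) (c r - c a) < l := by
    intro r hr
    apply hball
    rw [Real.dist_eq, abs_lt]
    constructor <;> linarith [hr.1, hr.2]
  have hderiv : ∀ r, HasDerivAt (fun r => ε * det2 (T a) (c r - c a))
      (ε * det2 (T a) (T r)) r := by
    intro r
    have := (((hasDerivAt_const r (T a)).det2 ((h.hasDerivAt r).sub_const (c a))).const_mul ε)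
    refine this.congr_deriv ?_
    simp [det2]
  have hslope : ∀ r ∈ Set.Ico t (t + d), ε * det2 (T a) (T r) ≤ 0 := by
    intro r hr
    obtain ⟨h1, h2⟩ := hnear r hr
    have h3 := h.support r b
    have h4 := h.support a r
    have h5 : ε * det2 (T r) (c b - c r) = -(dot2 (T a) (T r) * (ε * det2 (T a) (c r - c a)))
        - (ε * det2 (T a) (T r)) * (l - dot2 (T a) (c r - c a)) := by
      rw [hb]
      simp only [dot2, det2, PiLp.sub_apply, PiLp.add_apply, PiLp.smul_apply, smul_eq_mul] at *
      linear_combination (ε * (T r 0 * (c a 1 - c r 1) - T r 1 * (c a 0 - c r 0))) * (-hunit)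
    have h6 := mul_nonneg h1.le h4
    by_contra! h7
    nlinarith [mul_pos h7 (sub_pos.2 h2)]
  have hzero : ∀ r ∈ Set.Ico t (t + d), ε * det2 (T a) (c r - c a) = 0 := by
    have hanti : AntitoneOn (fun r => ε * det2 (T a) (c r - c a)) (Set.Ico t (t + d)) := by
      refine antitoneOn_of_deriv_nonpos (convex_Ico _ _)
        (fun r _ => (hderiv r).continuousAt.continuousWithinAt)
        (fun r _ => (hderiv r).differentiableAt.differentiableWithinAt) ?_
      intro r hr
      rw [(hderiv r).deriv]
      exact hslope r (interior_subset hr)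
    intro r hr
    have h1 := hanti ⟨le_refl t, by linarith⟩ hr hr.1
    have h2 : ε * det2 (T a) (c t - c a) = 0 := by
      rw [hct]
      simp only [det2, PiLp.sub_apply, PiLp.add_apply, PiLp.smul_apply, smul_eq_mul]
      ring
    simp only [h2] at h1
    exact le_antisymm h1 (h.support a r)
  have hε : ε ≠ 0 := by
    rintro rfl
    simpa using h.sign_sq
  have htan : ∀ r ∈ Set.Ico t (t + d), T r = T a := by
    intro r hr
    rcases eq_or_lt_of_le hr.1 with rfl | htr
    · exact hTt
    have h1 : (fun r => ε * det2 (T a) (c r - c a)) =ᶠ[𝓝 r] fun _ => 0 := by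
      filter_upwards [Ioo_mem_nhds htr hr.2] with q hq
      exact hzero q ⟨hq.1.le, hq.2⟩
    have h2 := (hderiv r).unique ((hasDerivAt_const r (0 : ℝ)).congr_of_eventuallyEq h1)
    exact eq_of_det2_eq_zero_of_dot2_pos hunit (h.unit r)
      ((mul_eq_zero.1 h2).resolve_left hε) (hnear r hr).1
  filter_upwards [Ioo_mem_nhdsGT (show t < t + d by linarith)] with r hr
  refine ⟨htan r ⟨hr.1.le, hr.2⟩, ?_⟩
  rw [h.eq_add_smul_of_tangent_eq htan r ⟨hr.1.le, hr.2.le⟩, hct, add_assoc, ← add_smul]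
  congr 2
  ring

lemma tangent_eq_of_mem_tangent (h : IsConvexCurve c T L ε) {a b l : ℝ} (hl : 0 < l)
    (hbL : b < a + L) (hb : c b = c a + l • T a) : ∀ t ∈ Set.Icc a b, T t = T a := by
  have hray := h.eq_add_smul_of_mem_tangent hb
  have hend : c b = c (a + l) := by
    rw [(hray (a + l) ⟨by linarith, le_refl _⟩).2, hb, add_sub_cancel_left]
  obtain ⟨k, hk⟩ := h.inj _ _ hend
  have hL := h.period_pos
  have hk' : 0 ≤ k := by
    by_contra! hneg
    have : (k : ℝ) ≤ -1 := by exact_mod_cast Int.le_sub_one_of_lt hneg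
    nlinarith
  have hk'' : (0 : ℝ) ≤ k := by exact_mod_cast hk'
  intro t ht
  refine (hray t ⟨ht.1, ?_⟩).1
  have := mul_nonneg hk'' hL.le
  linarith [ht.2]

lemma cutArea_eq_zero (h : IsConvexCurve c T L ε) {δ s : ℝ} (hδ : 0 ≤ δ)
    (hT : ∀ t ∈ Set.Icc s (s + δ * L), T t = T s) : cutArea c L δ s = 0 := by
  have hle : s ≤ s + δ * L := by nlinarith [h.period_pos]
  rw [cutArea, h.deriv_eq, intervalIntegral.integral_congr (g := fun _ => (0 : ℝ))]
  · simp
  · intro t ht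
    rw [Set.uIcc_of_le hle] at ht
    have := h.eq_add_smul_of_tangent_eq (fun r hr => hT r (Set.Ico_subset_Icc_self hr)) t ht
    simp only [this, hT t ht, det2, PiLp.sub_apply, PiLp.add_apply, PiLp.smul_apply, smul_eq_mul]
    ring

lemma det2_sub_eq_zero_of_cutArea (h : IsConvexCurve c T L ε) {δ s t : ℝ} (hδ : 0 < δ)
    (hs : cutArea c L δ s = 0) (ht : t ∈ Set.Icc s (s + δ * L)) :
    det2 (c t - c s) (T t) = 0 := by
  have hlt : s < s + δ * L := by nlinarith [mul_pos hδ h.period_pos]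
  have hc := h.continuous
  have hcont : Continuous fun t => ε * det2 (c t - c s) (T t) :=
    continuous_const.mul ((hc.sub continuous_const).det2 h.continuous_tangent)
  have hnonneg : ∀ t, 0 ≤ ε * det2 (c t - c s) (T t) := by
    intro t
    have h1 := h.support t s
    have h2 : det2 (c t - c s) (T t) = det2 (T t) (c s - c t) := by
      simp only [det2, PiLp.sub_apply]; ring
    rwa [h2]
  have hint : ∫ t in s..(s + δ * L), ε * det2 (c t - c s) (T t) = 0 := by
    rw [cutArea, h.deriv_eq] at hs
    rw [intervalIntegral.integral_const_mul]
    simp only [one_div, mul_eq_zero, inv_eq_zero, OfNat.ofNat_ne_zero, false_or] at hs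
    rw [hs, mul_zero]
  have hε : ε ≠ 0 := by
    rintro rfl
    simpa using h.sign_sq
  by_contra hne
  have := intervalIntegral.integral_pos hlt hcont.continuousOn (fun t _ => hnonneg t)
    ⟨t, ht, lt_of_le_of_ne (hnonneg t) (mul_ne_zero hε hne).symm⟩
  linarith

lemma exists_cutArea_ne_zero (h : IsConvexCurve c T L ε) {δ : ℝ} (hδ : 0 < δ) :
    ∃ s, cutArea c L δ s ≠ 0 := by
  by_contra! hzero
  have hL := h.period_pos
  have hv : 0 < δ * L := mul_pos hδ hL
  have hpar : ∀ s t, s < t → t < s + δ * L → det2 (T s) (T t) = 0 := by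
    intro s t hst hts
    have h1 : (fun r => det2 (c t - c r) (T t)) =ᶠ[𝓝 s] fun _ => 0 := by
      filter_upwards [Ioo_mem_nhds (show t - δ * L < s by linarith) hst] with r hr
      exact h.det2_sub_eq_zero_of_cutArea hδ (hzero r) ⟨hr.2.le, by linarith [hr.1]⟩
    have h2 := ((h.hasDerivAt s).const_sub (c t)).det2 (hasDerivAt_const s (T t))
    have h3 := h2.unique ((hasDerivAt_const s (0 : ℝ)).congr_of_eventuallyEq h1)
    simp only [det2, PiLp.neg_apply, PiLp.zero_apply] at h3 ⊢
    linarith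
  have hloc : IsLocallyConstant T := by
    rw [IsLocallyConstant.iff_eventually_eq]
    intro t
    have hpos : ∀ᶠ r in 𝓝 t, 0 < dot2 (T t) (T r) :=
      ((continuous_const.dot2 h.continuous_tangent).tendsto t).eventually_const_lt
        (by rw [h.unit]; norm_num)
    filter_upwards [hpos, Ioo_mem_nhds (show t - δ * L < t by linarith)
      (show t < t + δ * L by linarith)] with r hr hrt
    refine eq_of_det2_eq_zero_of_dot2_pos (h.unit t) (h.unit r) ?_ hr
    rcases lt_trichotomy t r with htr | rfl | htr
    · exact hpar t r htr hrt.2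
    · simp only [det2]; ring
    · have := hpar r t htr (by linarith [hrt.1])
      simp only [det2] at this ⊢
      linarith
  have hline := h.eq_add_smul_of_tangent_eq (a := 0) (b := L) (e := T 0)
    (fun t _ => hloc.apply_eq_of_preconnectedSpace t 0) L ⟨hL.le, le_refl L⟩
  have hper := h.periodic 0
  rw [zero_add] at hper
  rw [hper, sub_zero, left_eq_add, smul_eq_zero] at hline
  rcases hline with h0 | h0
  · exact hL.ne' h0
  · have := h.unit 0
    simp [h0, dot2] at this

/-- Constancy of the area cut off makes each chord parallel to the sum of the tangents at its
endpoints. -/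
lemma det2_chord_eq_zero (h : IsConvexCurve c T L ε) {δ K : ℝ}
    (hA : ∀ s, cutArea c L δ s = K) (s : ℝ) :
    det2 (c (s + δ * L) - c s) (T s + T (s + δ * L)) = 0 := by
  have hc := h.continuous
  have hg : Continuous fun t => det2 (c t) (T t) := hc.det2 h.continuous_tangent
  set P : ℝ → ℝ := fun s => ∫ t in (0 : ℝ)..s, det2 (c t) (T t)
  have hPd : ∀ s, HasDerivAt P (det2 (c s) (T s)) s := fun s =>
    intervalIntegral.integral_hasDerivAt_right (hg.intervalIntegrable _ _)
      (hg.stronglyMeasurableAtFilter _ _) hg.continuousAt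
  have harea : ∀ s, P (s + δ * L) - P s - det2 (c s) (c (s + δ * L)) = 2 * K := by
    intro s
    have hsplit : ∀ t, det2 (c t - c s) (T t) = det2 (c t) (T t) - det2 (c s) (T t) := by
      intro t
      simp only [det2, PiLp.sub_apply]
      ring
    have hchord : ∫ t in s..(s + δ * L), det2 (c s) (T t)
        = det2 (c s) (c (s + δ * L)) - det2 (c s) (c s) := by
      refine intervalIntegral.integral_eq_sub_of_hasDerivAt (f := fun t => det2 (c s) (c t))
        (fun t _ => ?_) ((continuous_const.det2 h.continuous_tangent).intervalIntegrable _ _)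
      refine ((hasDerivAt_const t (c s)).det2 (h.hasDerivAt t)).congr_deriv ?_
      simp [det2]
    have hself : det2 (c s) (c s) = 0 := by
      simp only [det2]; ring
    have hK := hA s
    simp only [cutArea, h.deriv_eq, hsplit] at hK
    rw [intervalIntegral.integral_sub (hg.intervalIntegrable _ _)
      ((continuous_const.det2 h.continuous_tangent).intervalIntegrable _ _), hchord, hself,
      ← intervalIntegral.integral_interval_sub_left (hg.intervalIntegrable 0 _)
        (hg.intervalIntegrable 0 _)] at hK
    linarith
  have hshift := (h.hasDerivAt (s + δ * L)).comp_add_const s (δ * L)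
  have hd := (((hPd (s + δ * L)).comp_add_const s (δ * L)).sub (hPd s)).sub
    ((h.hasDerivAt s).det2 hshift)
  have hd0 := hd.unique ((hasDerivAt_const s (2 * K)).congr_of_eventuallyEq
    (Eventually.of_forall harea))
  simp only [det2, PiLp.sub_apply, PiLp.add_apply] at hd0 ⊢
  linarith

lemma not_antipodal_twice (h : IsConvexCurve c T L ε) {v K : ℝ} (hv : L = 3 * v)
    (hA : ∀ s, cutArea c L (1 / 3) s = K) {s : ℝ} (h₀ : T s + T (s + v) = 0)
    (h₁ : T (s + v) + T (s + v + v) = 0) : False := by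
  have hL := h.period_pos
  have hvL : 1 / 3 * L = v := by rw [hv]; ring
  have hend : s + v + v + v = s + L := by rw [hv]; ring
  have hTs : T (s + v + v) = T s := by
    have e1 := eq_neg_of_add_eq_zero_left h₀
    have e2 := eq_neg_of_add_eq_zero_right h₁
    rw [e1, e2]
  have hchord := h.det2_chord_eq_zero hA (s + v + v)
  rw [hvL, hend, h.periodic, h.periodic_tangent, hTs] at hchord
  have hpar : det2 (T s) (c s - c (s + v + v)) = 0 := by
    simp only [det2, PiLp.sub_apply, PiLp.add_apply] at hchord ⊢
    linarith
  have hsm := eq_smul_of_det2_eq_zero (by rw [h.unit]; exact one_ne_zero) hpar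
  rw [h.unit, div_one] at hsm
  set l := dot2 (T s) (c s - c (s + v + v)) with hl
  rcases lt_trichotomy l 0 with hneg | hzero | hpos
  · have hQ : c (s + v + v) = c s + (-l) • T s := by
      rw [neg_smul, ← hsm]; abel
    have := h.tangent_eq_of_mem_tangent (neg_pos.2 hneg) (by linarith) hQ (s + v)
      ⟨by linarith, by linarith⟩
    rw [this] at h₀
    have h2 := h.unit s
    have h3 : T s = 0 := by
      have : (2 : ℝ) • T s = 0 := by rw [two_smul, h₀]
      simpa using this
    simp [h3, dot2] at h2
  · rw [hzero, zero_smul, sub_eq_zero] at hsm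
    exact h.ne_of_lt (by linarith) (by linarith) hsm
  · have hQ : c (s + L) = c (s + v + v) + l • T (s + v + v) := by
      rw [h.periodic, hTs, ← hsm]; abel
    have hconst := h.tangent_eq_of_mem_tangent hpos (by linarith) hQ
    have hz := h.cutArea_eq_zero (δ := 1 / 3) (s := s + v + v) (by norm_num)
      (by rwa [hvL, hend])
    obtain ⟨r, hr⟩ := h.exists_cutArea_ne_zero (δ := 1 / 3) (by norm_num)
    exact hr (by rw [hA, ← hA (s + v + v), hz])

lemma hasDerivAt_chord_sq (h : IsConvexCurve c T L ε) (v s : ℝ) :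
    HasDerivAt (fun s => dot2 (c (s + v) - c s) (c (s + v) - c s))
      (2 * dot2 (c (s + v) - c s) (T (s + v) - T s)) s := by
  have hd := ((h.hasDerivAt (s + v)).comp_add_const s v).sub (h.hasDerivAt s)
  refine (hd.dot2 hd).congr_deriv ?_
  simp only [dot2, PiLp.sub_apply, Pi.sub_apply]
  ring

end IsConvexCurve

lemma dot2_sub_eq_zero_of_det2_add_eq_zero {w t₀ t₁ : Plane} (h : dot2 t₀ t₀ = dot2 t₁ t₁)
    (hdet : det2 w (t₀ + t₁) = 0) (hne : t₀ + t₁ ≠ 0) : dot2 w (t₁ - t₀) = 0 := by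
  have hdet' : det2 (t₀ + t₁) w = 0 := by
    simp only [det2] at hdet ⊢; linarith
  have hw := eq_smul_of_det2_eq_zero (fun h0 => hne (dot2_self_eq_zero h0)) hdet'
  rw [hw]
  simp only [dot2, PiLp.sub_apply, PiLp.add_apply, PiLp.smul_apply, smul_eq_mul] at h ⊢
  linear_combination (-((t₀ 0 + t₁ 0) * w 0 + (t₀ 1 + t₁ 1) * w 1) /
    ((t₀ 0 + t₁ 0) * (t₀ 0 + t₁ 0) + (t₀ 1 + t₁ 1) * (t₀ 1 + t₁ 1))) * h

/-- If the tangents at the endpoints of a chord are opposite, the third vertex sees the chord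
under a right angle. -/
lemma dot2_eq_zero_of_antipodal {b d t₀ t₁ t₂ : Plane} (h₁₂ : dot2 t₁ t₁ = dot2 t₂ t₂)
    (h₀₁ : t₀ + t₁ = 0) (hb : det2 b (t₁ + t₂) = 0) (hd : det2 d (t₂ + t₀) = 0)
    (hb' : t₁ + t₂ ≠ 0) (hd' : t₂ + t₀ ≠ 0) : dot2 b d = 0 := by
  obtain rfl : t₀ = -t₁ := eq_neg_of_add_eq_zero_left h₀₁
  have hperp := dot2_sub_eq_zero_of_det2_add_eq_zero h₁₂ hb hb'
  have hdet : det2 (t₂ + -t₁) d = 0 := by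
    simp only [det2] at hd ⊢; linarith
  rw [eq_smul_of_det2_eq_zero (fun h0 => hd' (dot2_self_eq_zero h0)) hdet]
  simp only [dot2, PiLp.sub_apply, PiLp.add_apply, PiLp.neg_apply, PiLp.smul_apply,
    smul_eq_mul] at hperp ⊢
  linear_combination (((t₂ 0 + -t₁ 0) * d 0 + (t₂ 1 + -t₁ 1) * d 1) /
    ((t₂ 0 + -t₁ 0) * (t₂ 0 + -t₁ 0) + (t₂ 1 + -t₁ 1) * (t₂ 1 + -t₁ 1))) * hperp

namespace IsConvexCurve

variable {c T : ℝ → Plane} {L ε : ℝ}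

lemma dot2_chord_eq_zero (h : IsConvexCurve c T L ε) {v K : ℝ} (hv : L = 3 * v)
    (hA : ∀ s, cutArea c L (1 / 3) s = K) (s : ℝ) :
    dot2 (c (s + v) - c s) (T (s + v) - T s) = 0 := by
  have hc := h.continuous
  have hTc := h.continuous_tangent
  have hvL : 1 / 3 * L = v := by rw [hv]; ring
  have hend : ∀ s, s + v + v + v = s + L := fun s => by rw [hv]; ring
  have hchord : ∀ s, det2 (c (s + v) - c s) (T s + T (s + v)) = 0 := fun s => by
    have := h.det2_chord_eq_zero hA s
    rwa [hvL] at this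
  have hregular : ∀ s, T s + T (s + v) ≠ 0 →
      dot2 (c (s + v) - c s) (T (s + v) - T s) = 0 := fun s hs =>
    dot2_sub_eq_zero_of_det2_add_eq_zero (by rw [h.unit, h.unit]) (hchord s) hs
  by_contra hne
  have hanti : ∀ᶠ r in 𝓝 s, T r + T (r + v) = 0 := by
    have hcont : Continuous fun r => dot2 (c (r + v) - c r) (T (r + v) - T r) := by
      refine Continuous.dot2 ?_ ?_ <;> fun_prop
    filter_upwards [hcont.continuousAt.eventually_ne hne] with r hr
    by_contra hr'
    exact hr (hregular r hr')
  have hnext : ∀ r, T r + T (r + v) = 0 → T (r + v) + T (r + v + v) ≠ 0 :=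
    fun r h₀ h₁ => h.not_antipodal_twice hv hA h₀ h₁
  have hlast : ∀ r, T r + T (r + v) = 0 → T (r + v + v) + T (r + v + v + v) ≠ 0 := by
    intro r h₀ h₁
    refine h.not_antipodal_twice hv hA h₁ ?_
    rw [hend, h.periodic_tangent, add_right_comm r L v, h.periodic_tangent]
    exact h₀
  have hpyth : (fun r => dot2 (c (r + v) - c r) (c (r + v) - c r)) =ᶠ[𝓝 s] fun r =>
      dot2 (c (r + v + v) - c (r + v)) (c (r + v + v) - c (r + v)) +
      dot2 (c (r + v + v + v) - c (r + v + v)) (c (r + v + v + v) - c (r + v + v)) := by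
    filter_upwards [hanti] with r hr
    have hlast' := hlast r hr
    have hchord' := hchord (r + v + v)
    rw [hend, h.periodic_tangent] at hlast'
    rw [hend, h.periodic_tangent, h.periodic] at hchord'
    have hright := dot2_eq_zero_of_antipodal (by rw [h.unit, h.unit]) hr (hchord (r + v)) hchord'
      (hnext r hr) hlast'
    rw [hend, h.periodic]
    simp only [dot2, PiLp.sub_apply] at hright ⊢
    linear_combination 2 * hright
  have hs := hanti.self_of_nhds
  have hd := ((h.hasDerivAt_chord_sq v (s + v)).comp_add_const s v).add
    (((h.hasDerivAt_chord_sq v (s + v + v)).comp_add_const (s + v) v).comp_add_const s v)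
  have huniq := (h.hasDerivAt_chord_sq v s).unique (hd.congr_of_eventuallyEq hpyth)
  rw [hregular _ (hnext s hs), hregular _ (hlast s hs)] at huniq
  exact hne (by linarith)

end IsConvexCurve

/-- A vector orthogonal to two linearly independent plane vectors vanishes. -/
lemma eq_zero_of_dot2_eq_zero {a b w : Plane} (hab : det2 a b ≠ 0) (ha : dot2 w a = 0)
    (hb : dot2 w b = 0) : w = 0 := by
  simp only [dot2, det2] at *
  apply plane_ext <;> simp only [PiLp.zero_apply] <;> apply mul_left_cancel₀ hab <;>
    rw [mul_zero]
  · linear_combination (b 1) * ha - (a 1) * hb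
  · linear_combination (a 0) * hb - (b 0) * ha

/-- In an equilateral triangle with sides `a`, `b`, `-a - b`, unit vectors at the vertices making
equal angles with the sides are the tangents of the circumscribed circle. -/
lemma equilateral_tangents {a b t₀ t₁ t₂ : Plane} {m : ℝ} (hm : m ≠ 0) (haa : dot2 a a = m)
    (hbb : dot2 b b = m) (hdd : dot2 (-a - b) (-a - b) = m)
    (h₀ : det2 a (t₀ + t₁) = 0) (h₁ : det2 b (t₁ + t₂) = 0)
    (e₀ : dot2 a (t₁ - t₀) = 0) (e₁ : dot2 b (t₂ - t₁) = 0)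
    (e₂ : dot2 (-a - b) (t₀ - t₂) = 0) :
    t₀ + t₁ + t₂ = 0 ∧ dot2 (a - (-a - b)) t₀ = 0 := by
  have hab : dot2 a b = -m / 2 := by
    simp only [dot2, PiLp.sub_apply, PiLp.neg_apply] at *
    linear_combination (1 / 2) * (hdd - haa - hbb)
  have hs₀ := eq_smul_of_det2_eq_zero (by rwa [haa]) h₀
  have hs₁ := eq_smul_of_det2_eq_zero (by rwa [hbb]) h₁
  rw [haa] at hs₀
  rw [hbb] at hs₁
  have hdet : det2 a b ≠ 0 := by
    intro h0
    have : dot2 a b ^ 2 + det2 a b ^ 2 = dot2 a a * dot2 b b := by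
      simp only [dot2, det2]; ring
    rw [h0, hab, haa, hbb] at this
    have : m ^ 2 = 0 := by linarith
    exact hm (by simpa using this)
  have k₀ : dot2 (t₀ + t₁) b = -(dot2 a t₀) := by
    have hlin : dot2 (t₀ + t₁) b = (dot2 a (t₀ + t₁) / m) * dot2 a b := by
      conv_lhs => rw [hs₀]
      simp only [dot2, PiLp.smul_apply, smul_eq_mul]; ring
    rw [hlin, hab]
    have : dot2 a (t₀ + t₁) = 2 * dot2 a t₀ := by
      simp only [dot2, PiLp.sub_apply, PiLp.add_apply] at *; linarith
    rw [this]
    field_simp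
  have k₁ : dot2 (t₁ + t₂) a = -(dot2 b t₁) := by
    have hlin : dot2 (t₁ + t₂) a = (dot2 b (t₁ + t₂) / m) * dot2 a b := by
      conv_lhs => rw [hs₁]
      simp only [dot2, PiLp.smul_apply, smul_eq_mul]; ring
    rw [hlin, hab]
    have : dot2 b (t₁ + t₂) = 2 * dot2 b t₁ := by
      simp only [dot2, PiLp.sub_apply, PiLp.add_apply] at *; linarith
    rw [this]
    field_simp
  clear hs₀ hs₁ h₀ h₁
  refine ⟨eq_zero_of_dot2_eq_zero hdet ?_ ?_, ?_⟩ <;>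
    simp only [dot2, PiLp.sub_apply, PiLp.add_apply, PiLp.neg_apply] at * <;> linarith

namespace IsConvexCurve

variable {c T : ℝ → Plane} {L ε : ℝ}

lemma exists_norm_sub_eq (h : IsConvexCurve c T L ε) {K : ℝ}
    (hA : ∀ s, cutArea c L (1 / 3) s = K) :
    ∃ (x₀ : Plane) (r : ℝ), 0 < r ∧ ∀ s, ‖c s - x₀‖ = r := by
  obtain ⟨v, hv⟩ : ∃ v, L = 3 * v := ⟨L / 3, by ring⟩
  have hL := h.period_pos
  have hvL : 1 / 3 * L = v := by rw [hv]; ring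
  have hend : ∀ s, s + v + v + v = s + L := fun s => by rw [hv]; ring
  have hdot := h.dot2_chord_eq_zero hv hA
  have hchord : ∀ s, det2 (c (s + v) - c s) (T s + T (s + v)) = 0 := fun s => by
    have := h.det2_chord_eq_zero hA s
    rwa [hvL] at this
  have hside := is_const_of_deriv_eq_zero
    (fun s => (h.hasDerivAt_chord_sq v s).differentiableAt)
    (fun s => by rw [(h.hasDerivAt_chord_sq v s).deriv, hdot, mul_zero])
  set m := dot2 (c (0 + v) - c 0) (c (0 + v) - c 0) with hm
  have hside' : ∀ s, dot2 (c (s + v) - c s) (c (s + v) - c s) = m := fun s => hside s 0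
  have hm0 : m ≠ 0 := fun h0 => h.ne_of_lt (s := 0) (t := 0 + v) (by linarith) (by linarith)
    (sub_eq_zero.1 (dot2_self_eq_zero h0)).symm
  have htri : ∀ s, T s + T (s + v) + T (s + v + v) = 0 ∧
      dot2 ((c (s + v) - c s) - (c s - c (s + v + v))) (T s) = 0 := by
    intro s
    have hthird : c s - c (s + v + v) = -(c (s + v) - c s) - (c (s + v + v) - c (s + v)) := by
      abel
    have hdd := hside' (s + v + v)
    have e₂ := hdot (s + v + v)
    rw [hend, h.periodic, hthird] at hdd e₂
    rw [h.periodic_tangent] at e₂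
    have := equilateral_tangents hm0 (hside' s) (hside' (s + v)) hdd (hchord s)
      (hchord (s + v)) (hdot s) (hdot (s + v)) e₂
    rwa [← hthird] at this
  have hcenter : ∀ s, HasDerivAt (fun s => c s + c (s + v) + c (s + v + v)) 0 s := by
    intro s
    have hd := ((h.hasDerivAt s).add ((h.hasDerivAt (s + v)).comp_add_const s v)).add
      (((h.hasDerivAt (s + v + v)).comp_add_const (s + v) v).comp_add_const s v)
    rwa [(htri s).1] at hd
  have hcconst := is_const_of_deriv_eq_zero (fun s => (hcenter s).differentiableAt)
    (fun s => (hcenter s).deriv)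
  set x₀ : Plane := (1 / 3 : ℝ) • (c 0 + c (0 + v) + c (0 + v + v)) with hx₀
  have hx : ∀ s, x₀ = (1 / 3 : ℝ) • (c s + c (s + v) + c (s + v + v)) := fun s => by
    rw [hx₀]
    exact congrArg _ (hcconst 0 s)
  have hradius : ∀ s, HasDerivAt (fun s => dot2 (c s - x₀) (c s - x₀)) 0 s := by
    intro s
    have hd := (h.hasDerivAt s).sub_const x₀
    refine (hd.dot2 hd).congr_deriv ?_
    have hperp := (htri s).2
    rw [hx s]
    simp only [dot2, PiLp.sub_apply, PiLp.add_apply, PiLp.smul_apply, smul_eq_mul] at hperp ⊢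
    linear_combination (-(2 / 3)) * hperp
  have hrconst := is_const_of_deriv_eq_zero (fun s => (hradius s).differentiableAt)
    (fun s => (hradius s).deriv)
  have hnorm : ∀ s, ‖c s - x₀‖ = ‖c 0 - x₀‖ := by
    intro s
    rw [← sq_eq_sq₀ (norm_nonneg _) (norm_nonneg _), norm_sq_eq_dot2, norm_sq_eq_dot2]
    exact hrconst s 0
  refine ⟨x₀, ‖c 0 - x₀‖, lt_of_le_of_ne (norm_nonneg _) fun h0 => ?_, hnorm⟩
  have h1 : c 0 = x₀ := by rw [← sub_eq_zero, ← norm_eq_zero, ← h0]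
  have h2 : c v = x₀ := by rw [← sub_eq_zero, ← norm_eq_zero, hnorm, ← h0]
  exact h.ne_of_lt (s := 0) (t := v) (by linarith) (by linarith) (h1.trans h2.symm)

end IsConvexCurve

/-- A tangent line at a boundary point of a convex plane body supports the body. -/
lemma exists_support {Ω : Set Plane} (hconv : Convex ℝ Ω) (hint : (interior Ω).Nonempty)
    {c : ℝ → Plane} {s : ℝ} {u : Plane} (hd : HasDerivAt c u s) (hu : dot2 u u = 1)
    (hc : ∀ t, c t ∈ frontier Ω) :
    ∃ κ : ℝ, (∀ y ∈ interior Ω, κ * det2 u (y - c s) < 0) ∧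
      ∀ t, κ * det2 u (c t - c s) ≤ 0 := by
  obtain ⟨f, hf⟩ := geometric_hahn_banach_open_point hconv.interior isOpen_interior
    (hc s).2
  have hclosure : ∀ t, f (c t) ≤ f (c s) := by
    intro t
    have hmem : c t ∈ closure (interior Ω) := by
      rw [hconv.closure_interior_eq_closure_of_nonempty_interior hint]
      exact (hc t).1
    exact closure_minimal (fun y hy => (hf y hy).le)
      (isClosed_le f.continuous continuous_const) hmem
  have hmax : IsLocalMax (fun t => f (c t)) s := Eventually.of_forall hclosure
  have hfu : f u = 0 := hmax.hasDerivAt_eq_zero (f.hasFDerivAt.comp_hasDerivAt s hd)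
  set n : Plane := !₂[-u 1, u 0] with hn
  have hdecomp : ∀ w : Plane, f w = f n * det2 u w := by
    intro w
    have hw : w = dot2 u w • u + det2 u w • n := by
      apply plane_ext <;> simp only [hn, dot2, det2, PiLp.add_apply, PiLp.smul_apply,
        smul_eq_mul] at hu ⊢ <;> simp
      · linear_combination (-w 0) * hu
      · linear_combination (-w 1) * hu
    conv_lhs => rw [hw]
    rw [map_add, map_smul, map_smul, hfu, smul_zero, zero_add, smul_eq_mul, mul_comm]
  refine ⟨f n, fun y hy => ?_, fun t => ?_⟩
  · rw [← hdecomp, map_sub]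
    linarith [hf y hy]
  · rw [← hdecomp, map_sub]
    linarith [hclosure t]

/-- The boundary of a convex plane body lies on one side of each of its tangent lines. -/
lemma IsArclengthParam.exists_isConvexCurve {Ω : Set Plane} {c : ℝ → Plane} {L : ℝ}
    (hparam : IsArclengthParam Ω c L) (hconv : Convex ℝ Ω) (hint : (interior Ω).Nonempty) :
    ∃ ε, IsConvexCurve c (deriv c) L ε := by
  have hd : ∀ s, HasDerivAt c (deriv c s) s := fun s =>
    (hparam.contDiff.differentiable one_ne_zero s).hasDerivAt
  have hcont : Continuous (deriv c) := hparam.contDiff.continuous_deriv le_rfl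
  have hc : Continuous c := hparam.contDiff.continuous
  have hunit : ∀ s, dot2 (deriv c s) (deriv c s) = 1 := fun s => by
    rw [← norm_sq_eq_dot2, hparam.unitSpeed, one_pow]
  have hmem : ∀ t, c t ∈ frontier Ω := fun t => hparam.range_eq ▸ Set.mem_range_self t
  obtain ⟨p, hp⟩ := hint
  set D : ℝ → ℝ := fun s => det2 (deriv c s) (p - c s) 
  have hDc : Continuous D := hcont.det2 (continuous_const.sub hc)
  have hsupp : ∀ s, D s ≠ 0 ∧ ∀ t, 0 ≤ D s * det2 (deriv c s) (c t - c s) := by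
    intro s
    obtain ⟨κ, hκ₁, hκ₂⟩ := exists_support hconv ⟨p, hp⟩ (hd s) (hunit s) hmem
    have h1 : κ * D s < 0 := hκ₁ p hp
    refine ⟨fun h0 => by simp [h0] at h1, fun t => ?_⟩
    have h3 : 0 ≤ (κ * D s) * (κ * det2 (deriv c s) (c t - c s)) :=
      mul_nonneg_of_nonpos_of_nonpos h1.le (hκ₂ t)
    have hκ : κ ≠ 0 := by
      rintro rfl
      simp at h1
    have hκ2 : 0 < κ ^ 2 := by positivity
    refine nonneg_of_mul_nonneg_right (a := κ ^ 2) ?_ hκ2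
    linarith [h3]
  have hsign : (∀ s, 0 < D s) ∨ ∀ s, D s < 0 := by
    by_contra! hcon
    obtain ⟨⟨a, ha⟩, b, hb⟩ := hcon
    obtain ⟨s, hs⟩ := mem_range_of_exists_le_of_exists_ge hDc ⟨a, ha⟩ ⟨b, hb⟩
    exact (hsupp s).1 hs
  have hperT : ∀ s, deriv c (s + L) = deriv c s := fun s => by
    have := deriv_comp_add_const (f := c) (a := L) (x := s)
    rw [← this]
    congr 1
    exact funext hparam.periodic
  have hinj : ∀ s t, c s = c t → ∃ k : ℤ, t = s + k * L := by
    intro s t hst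
    have hmod : ∀ r, c (toIcoMod hparam.hL 0 r) = c r := fun r => by
      rw [toIcoMod, hparam.periodic.sub_zsmul_eq]
    have hIco : ∀ r, toIcoMod hparam.hL 0 r ∈ Set.Ico 0 L := fun r => by
      simpa using toIcoMod_mem_Ico hparam.hL 0 r
    have := hparam.injOn (hIco s) (hIco t) (by rw [hmod, hmod, hst])
    refine ⟨toIcoDiv hparam.hL 0 t - toIcoDiv hparam.hL 0 s, ?_⟩
    rw [toIcoMod, toIcoMod, zsmul_eq_mul, zsmul_eq_mul] at this
    push_cast
    linarith
  rcases hsign with hpos | hneg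
  · refine ⟨1, hparam.hL, hd, hcont, hunit, hparam.periodic, hperT, hinj, by norm_num, ?_⟩
    intro s t
    rw [one_mul]
    exact nonneg_of_mul_nonneg_right ((hsupp s).2 t) (hpos s)
  · refine ⟨-1, hparam.hL, hd, hcont, hunit, hparam.periodic, hperT, hinj, by norm_num, ?_⟩
    intro s t
    have h1 := (hsupp s).2 t
    have h2 := hneg s
    by_contra! h3
    nlinarith

/-- Salkowski-type, density `1/3`: a compact convex plane body
that floats in the archimedean sense in equilibrium in every orientation at
density `δ = 1/3` has circular boundary. -/
theorem floating_third_imp_circle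
    (Ω : Set Plane) (c : ℝ → Plane) (L : ℝ)
    (hcomp : IsCompact Ω) (hconv : Convex ℝ Ω) (hint : (interior Ω).Nonempty)
    (hparam : IsArclengthParam Ω c L)
    (harea : ∀ s : ℝ, cutArea c L (1 / 3) s = cutArea c L (1 / 3) 0) :
    ∃ (x₀ : Plane) (r : ℝ), 0 < r ∧ ∀ s : ℝ, ‖c s - x₀‖ = r := by
  obtain ⟨ε, h⟩ := hparam.exists_isConvexCurve hconv hint
  exact h.exists_norm_sub_eq harea
end

section
/- Let Ω ⊂ ℝ² be a compact convex body with C¹ arclength boundary parametrization c of period L, and suppose A_{1/4}(s) = A_{1/4}(0) for all s, where A_{1/4}(s) = (1/2)·∫_s^{s+L/4} det(c(t) − c(s), c'(t)) dt. Then the boundary of Ω is a circle: there exist x₀ ∈ ℝ² and r > 0 with ‖c(s) − x₀‖ = r for all s. -/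
open Real InnerProductGeometry

open Filter Topology

/-- A closed plane curve `(X, Y)` of perimeter `4 * q`, parametrized by arclength, whose tangent
direction has the nondecreasing continuous angle `θ` of total turning `2π`. -/
structure IsConvexCurve_s14 (X Y θ : ℝ → ℝ) (q : ℝ) : Prop where
  pos : 0 < q
  hasDerivAt_fst : ∀ s, HasDerivAt X (cos (θ s)) s
  hasDerivAt_snd : ∀ s, HasDerivAt Y (sin (θ s)) s
  continuous : Continuous θ
  monotone : Monotone θ
  turning : ∀ s, θ (s + 4 * q) = θ s + 2 * π
  periodic_fst : ∀ s, X (s + 4 * q) = X s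
  periodic_snd : ∀ s, Y (s + 4 * q) = Y s

/-- The component in the direction of angle `μ` of the vector from `(X s, Y s)` to
`(X t, Y t)`. -/
noncomputable def chordComp (X Y : ℝ → ℝ) (μ s t : ℝ) : ℝ :=
  cos μ * (X t - X s) + sin μ * (Y t - Y s)

/-- The angle halfway between the tangents at the ends of the arc of length `q` from `s`. -/
noncomputable def midAngle (θ : ℝ → ℝ) (q s : ℝ) : ℝ := (θ s + θ (s + q)) / 2

/-- Half the turning of the tangent along the arc of length `q` from `s`. -/
noncomputable def halfTurn (θ : ℝ → ℝ) (q s : ℝ) : ℝ := (θ (s + q) - θ s) / 2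

/-- The chord of the arc of length `q` from `s` makes equal angles with the tangents at its
ends, unless these are antiparallel. -/
def HasBisectingChords (X Y θ : ℝ → ℝ) (q : ℝ) : Prop :=
  ∀ s, (X (s + q) - X s) * (sin (θ (s + q)) + sin (θ s)) =
    (Y (s + q) - Y s) * (cos (θ (s + q)) + cos (θ s))

lemma chordComp_rotate (X Y : ℝ → ℝ) (μ ν s t : ℝ) :
    chordComp X Y ν s t = cos (ν - μ) * chordComp X Y μ s t +
      sin (ν - μ) * chordComp X Y (μ + π / 2) s t := by
  unfold chordComp
  have h1 : cos ν = cos (ν - μ) * cos μ - sin (ν - μ) * sin μ := by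
    rw [← cos_add]; ring_nf
  have h2 : sin ν = sin (ν - μ) * cos μ + cos (ν - μ) * sin μ := by
    rw [← sin_add]; ring_nf
  rw [h1, h2, cos_add_pi_div_two, sin_add_pi_div_two]
  ring

lemma chordComp_trans (X Y : ℝ → ℝ) (μ s t u : ℝ) :
    chordComp X Y μ s t + chordComp X Y μ t u = chordComp X Y μ s u := by
  unfold chordComp; ring

namespace IsConvexCurve_s14

variable {X Y θ : ℝ → ℝ} {q : ℝ}

lemma hasDerivAt_chordComp_right (h : IsConvexCurve_s14 X Y θ q) (μ s t : ℝ) :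
    HasDerivAt (fun t => chordComp X Y μ s t) (cos (θ t - μ)) t := by
  have := (((h.hasDerivAt_fst t).sub_const (X s)).const_mul (cos μ)).add
    (((h.hasDerivAt_snd t).sub_const (Y s)).const_mul (sin μ))
  exact this.congr_deriv (by rw [cos_sub]; ring)

lemma hasDerivAt_chordComp (h : IsConvexCurve_s14 X Y θ q) (μ s : ℝ) :
    HasDerivAt (fun t => chordComp X Y μ t (t + q))
      (cos (θ (s + q) - μ) - cos (θ s - μ)) s := by
  have := ((((h.hasDerivAt_fst (s + q)).comp_add_const s q).sub (h.hasDerivAt_fst s)).const_mul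
    (cos μ)).add
    ((((h.hasDerivAt_snd (s + q)).comp_add_const s q).sub (h.hasDerivAt_snd s)).const_mul (sin μ))
  exact this.congr_deriv (by rw [cos_sub, cos_sub]; ring)

lemma le_chordComp (h : IsConvexCurve_s14 X Y θ q) {μ a b κ : ℝ} (hab : a ≤ b)
    (hκ : ∀ t ∈ Set.Icc a b, κ ≤ cos (θ t - μ)) : κ * (b - a) ≤ chordComp X Y μ a b := by
  have := (convex_Icc a b).mul_sub_le_image_sub_of_le_deriv
    (f := fun t => chordComp X Y μ a t) (C := κ)
    (fun t _ => (h.hasDerivAt_chordComp_right μ a t).continuousAt.continuousWithinAt)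
    (fun t _ => (h.hasDerivAt_chordComp_right μ a t).differentiableAt.differentiableWithinAt)
    (fun t ht => by
      rw [(h.hasDerivAt_chordComp_right μ a t).deriv]
      exact hκ t (interior_subset ht))
    a (Set.left_mem_Icc.2 hab) b (Set.right_mem_Icc.2 hab) hab
  simpa [chordComp] using this

lemma chordComp_le (h : IsConvexCurve_s14 X Y θ q) {μ a b κ : ℝ} (hab : a ≤ b)
    (hκ : ∀ t ∈ Set.Icc a b, cos (θ t - μ) ≤ κ) : chordComp X Y μ a b ≤ κ * (b - a) := by
  have := h.le_chordComp (μ := μ + π) (κ := -κ) hab (fun t ht => by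
    rw [← sub_sub, cos_sub_pi]; exact neg_le_neg (hκ t ht))
  simp only [chordComp, cos_add_pi, sin_add_pi] at this ⊢
  linarith

lemma abs_chordComp_le (h : IsConvexCurve_s14 X Y θ q) (μ s : ℝ) :
    |chordComp X Y μ s (s + q)| ≤ q := by
  have h1 := h.le_chordComp (μ := μ) (κ := -1) (by linarith [h.pos] : s ≤ s + q)
    fun t _ => neg_one_le_cos _
  have h2 := h.chordComp_le (μ := μ) (κ := 1) (by linarith [h.pos] : s ≤ s + q)
    fun t _ => cos_le_one _
  rw [abs_le]; constructor <;> linarith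

lemma chordComp_period (h : IsConvexCurve_s14 X Y θ q) (μ s : ℝ) :
    chordComp X Y μ s (s + 4 * q) = 0 := by
  simp [chordComp, h.periodic_fst, h.periodic_snd]

lemma halfTurn_nonneg (h : IsConvexCurve_s14 X Y θ q) (s : ℝ) : 0 ≤ halfTurn θ q s := by
  have := h.monotone (by linarith [h.pos] : s ≤ s + q)
  unfold halfTurn; linarith

lemma halfTurn_le_pi (h : IsConvexCurve_s14 X Y θ q) (s : ℝ) : halfTurn θ q s ≤ π := by
  have := h.monotone (by linarith [h.pos] : s + q ≤ s + 4 * q)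
  have := h.turning s
  unfold halfTurn; linarith

lemma le_chordComp_midAngle (h : IsConvexCurve_s14 X Y θ q) {s : ℝ} :
    q * cos (halfTurn θ q s) ≤ chordComp X Y (midAngle θ q s) s (s + q) := by
  have := h.le_chordComp (μ := midAngle θ q s) (κ := cos (halfTurn θ q s))
    (by linarith [h.pos] : s ≤ s + q) (fun t ht => by
      rw [← cos_abs (θ t - _)]
      have h1 := h.monotone ht.1
      have h2 := h.monotone ht.2
      refine cos_le_cos_of_nonneg_of_le_pi (abs_nonneg _) (h.halfTurn_le_pi s) ?_
      rw [abs_le]; unfold midAngle halfTurn; constructor <;> linarith)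
  linarith

/-- The component of the chord orthogonal to the bisector of the end tangents. -/
lemma cos_halfTurn_mul_chordComp (hA : HasBisectingChords X Y θ q) (s : ℝ) :
    cos (halfTurn θ q s) * chordComp X Y (midAngle θ q s + π / 2) s (s + q) = 0 := by
  have h1 : θ (s + q) = midAngle θ q s + halfTurn θ q s := by
    unfold midAngle halfTurn; ring
  have h2 : θ s = midAngle θ q s - halfTurn θ q s := by
    unfold midAngle halfTurn; ring
  have := hA s
  rw [h1, h2, sin_add, sin_sub, cos_add, cos_sub] at this
  unfold chordComp
  rw [cos_add_pi_div_two, sin_add_pi_div_two]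
  linarith

lemma chordComp_eq_zero (h : IsConvexCurve_s14 X Y θ q) (hA : HasBisectingChords X Y θ q) {s : ℝ}
    (hs : halfTurn θ q s ≠ π / 2) :
    chordComp X Y (midAngle θ q s + π / 2) s (s + q) = 0 := by
  refine (mul_eq_zero.1 (cos_halfTurn_mul_chordComp hA s)).resolve_left fun h0 => hs ?_
  refine injOn_cos ⟨h.halfTurn_nonneg s, h.halfTurn_le_pi s⟩ ?_ (by rw [h0, cos_pi_div_two])
  constructor <;> linarith [pi_pos]

lemma continuous_halfTurn (h : IsConvexCurve_s14 X Y θ q) : Continuous (halfTurn θ q) := by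
  have := h.continuous
  unfold halfTurn; fun_prop

lemma continuous_midAngle (h : IsConvexCurve_s14 X Y θ q) : Continuous (midAngle θ q) := by
  have := h.continuous
  unfold midAngle; fun_prop

/-- The bisector of the end tangents turns, along with the chord, at the rate
`2 sin u / a`, where `u` is the half turning and `a` the length of the chord. -/
lemma tendsto_sin_midAngle (h : IsConvexCurve_s14 X Y θ q) (hA : HasBisectingChords X Y θ q) {s : ℝ}
    (hs : halfTurn θ q s < π / 2) :
    Tendsto (fun t => sin (midAngle θ q t - midAngle θ q s) / (t - s)) (𝓝[≠] s)
      (𝓝 (2 * sin (halfTurn θ q s) / chordComp X Y (midAngle θ q s) s (s + q))) := by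
  set m := midAngle θ q s with hm
  have hpos : 0 < chordComp X Y m s (s + q) :=
    (mul_pos h.pos (cos_pos_of_mem_Ioo ⟨by linarith [h.halfTurn_nonneg s, pi_pos], hs⟩)).trans_le
      h.le_chordComp_midAngle
  have hP : Tendsto (fun t => chordComp X Y m t (t + q)) (𝓝[≠] s)
      (𝓝 (chordComp X Y m s (s + q))) :=
    (h.hasDerivAt_chordComp m s).continuousAt.tendsto.mono_left nhdsWithin_le_nhds
  have hQ := (h.hasDerivAt_chordComp (m + π / 2) s).tendsto_slope
  have hd : cos (θ (s + q) - (m + π / 2)) - cos (θ s - (m + π / 2)) =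
      2 * sin (halfTurn θ q s) := by
    rw [← sub_sub, ← sub_sub, cos_sub_pi_div_two, cos_sub_pi_div_two,
      show θ (s + q) - m = halfTurn θ q s by rw [hm]; unfold midAngle halfTurn; ring,
      show θ s - m = -halfTurn θ q s by rw [hm]; unfold midAngle halfTurn; ring, sin_neg]
    ring
  rw [hd] at hQ
  have hc : Tendsto (fun t => cos (midAngle θ q t - m)) (𝓝[≠] s) (𝓝 1) := by
    have : Continuous fun t => cos (midAngle θ q t - m) := by
      have := h.continuous_midAngle
      fun_prop
    have h2 := (this.tendsto s).mono_left (nhdsWithin_le_nhds (s := {s}ᶜ))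
    simpa [← hm] using h2
  have hlim := (hc.mul hQ).div hP hpos.ne'
  rw [one_mul] at hlim
  refine hlim.congr' ?_
  have hev : ∀ᶠ t in 𝓝 s, halfTurn θ q t < π / 2 :=
    h.continuous_halfTurn.continuousAt.eventually_lt continuousAt_const hs
  filter_upwards [nhdsWithin_le_nhds hev, hP.eventually (lt_mem_nhds hpos),
    self_mem_nhdsWithin] with t ht hPt hne
  have h0 := h.chordComp_eq_zero hA ht.ne
  rw [chordComp_rotate X Y m, add_sub_right_comm, cos_add_pi_div_two, sin_add_pi_div_two] at h0
  have hb : chordComp X Y (m + π / 2) s (s + q) = 0 := h.chordComp_eq_zero hA hs.ne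
  have hne' : t - s ≠ 0 := sub_ne_zero.2 hne
  rw [Pi.div_apply, slope_def_field, hb]
  generalize chordComp X Y (m + π / 2) t (t + q) = Q at h0
  field_simp
  linarith

end IsConvexCurve_s14

/-- If the angle `2 * μ` is at least `ε` in the direction of `k`, both being small, then
`2 * sin μ` is at least `sin ε` in that direction. -/
lemma sin_div_le_two_mul_sin_div {ε μ k : ℝ} (hk : k ≠ 0) (hε : 0 ≤ ε * k)
    (h : 0 ≤ (2 * μ - ε) * k) (hμ : |μ| < π / 4) : sin ε / k ≤ 2 * (sin μ / k) := by
  rw [abs_lt] at hμ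
  have hc := cos_le_one μ
  rw [← mul_div_assoc]
  rcases lt_or_gt_of_ne hk with hk | hk
  · have h1 : ε ≤ 0 := by by_contra! hh; nlinarith
    have h2 : 2 * μ ≤ ε := by by_contra! hh; nlinarith
    rw [div_le_div_right_of_neg hk]
    have h3 := sin_le_sin_of_le_of_le_pi_div_two (by linarith) (by linarith [pi_pos]) h2
    have h4 : sin μ ≤ 0 := sin_nonpos_of_nonpos_of_neg_pi_le (by linarith) (by linarith)
    rw [sin_two_mul] at h3
    nlinarith
  · have h1 : 0 ≤ ε := by by_contra! hh; nlinarith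
    have h2 : ε ≤ 2 * μ := by by_contra! hh; nlinarith
    rw [div_le_div_iff_of_pos_right hk]
    have h3 := sin_le_sin_of_le_of_le_pi_div_two (by linarith [pi_pos]) (by linarith) h2
    have h4 : 0 ≤ sin μ := sin_nonneg_of_nonneg_of_le_pi (by linarith) (by linarith)
    rw [sin_two_mul] at h3
    nlinarith

/-- Two angles whose tangents are at least `1 / 2` and whose sum is at most `π / 2` have
tangents at most `2`. -/
lemma two_fifths_le_sin_mul_cos {u v : ℝ} (hu : 0 ≤ u) (hv : 0 ≤ v) (huv : u + v ≤ π / 2)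
    (h1 : cos u ≤ 2 * sin u) (h2 : cos v ≤ 2 * sin v) : 2 / 5 ≤ sin u * cos u := by
  have a1 : sin u ≤ cos v := by
    rw [← cos_pi_div_two_sub]
    exact cos_le_cos_of_nonneg_of_le_pi hv (by linarith) (by linarith)
  have a2 : sin v ≤ cos u := by
    rw [← cos_pi_div_two_sub]
    exact cos_le_cos_of_nonneg_of_le_pi hu (by linarith) (by linarith)
  nlinarith [mul_nonneg (sub_nonneg.2 h1) (by linarith : 0 ≤ 2 * cos u - sin u),
    sin_sq_add_cos_sq u]

namespace IsConvexCurve_s14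

variable {X Y θ : ℝ → ℝ} {q : ℝ}

/-- Let the end tangents of the arc from `b` be antiparallel, at `b` and along a filter `F`
approaching `b`, and orthogonal to the chord at `b`, the chord being shorter along `F` than
at `b`. Then a chord at a later quarter adjacent to the arc is at most `2 * r * sin u`, where `r`
is the length of the chord at `b` and `u` the half turning at that quarter. -/
lemma chordComp_le_of_antiparallel (h : IsConvexCurve_s14 X Y θ q)
    (hA : HasBisectingChords X Y θ q) {b d : ℝ} {F : Filter ℝ} [F.NeBot] (hF : F ≤ 𝓝[≠] b)
    (hb : θ (b + q) = θ b + π)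
    (h0 : chordComp X Y (θ (b + q)) b (b + q) = 0)
    (hr : chordComp X Y (θ (b + q) + π / 2) b (b + q) < 0)
    (hsign : ∀ᶠ s in F, chordComp X Y (θ (s + q)) s (s + q) * (s - b) ≤ 0)
    (hd : halfTurn θ q (b + d) < π / 2)
    (hturn : ∀ᶠ s in F, 0 ≤ (2 * (midAngle θ q (s + d) - midAngle θ q (b + d)) -
      (θ (s + q) - θ (b + q))) * (s - b)) :
    chordComp X Y (midAngle θ q (b + d)) (b + d) (b + d + q) ≤
      2 * -chordComp X Y (θ (b + q) + π / 2) b (b + q) * sin (halfTurn θ q (b + d)) := by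
  set β := θ (b + q) with hβ
  have hapos : 0 < chordComp X Y (midAngle θ q (b + d)) (b + d) (b + d + q) :=
    (mul_pos h.pos (cos_pos_of_mem_Ioo
      ⟨by linarith [h.halfTurn_nonneg (b + d), pi_pos], hd⟩)).trans_le h.le_chordComp_midAngle
  have hshift : Tendsto (fun s => s + d) F (𝓝[≠] (b + d)) := by
    refine tendsto_nhdsWithin_iff.2 ⟨?_, ?_⟩
    · exact ((continuous_add_const d).tendsto b).mono_left (hF.trans nhdsWithin_le_nhds)
    · filter_upwards [hF self_mem_nhdsWithin] with s hs
      simpa using hs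
  have hM := (h.tendsto_sin_midAngle hA hd).comp hshift
  have hP := (h.hasDerivAt_chordComp β b).tendsto_slope.mono_left hF
  have hdP : cos (θ (b + q) - β) - cos (θ b - β) = 2 := by
    rw [show θ b - β = -π by rw [hb]; ring, hβ, sub_self, cos_neg]; simp; norm_num
  rw [hdP] at hP
  have hQ : Tendsto (fun t => -chordComp X Y (β + π / 2) t (t + q)) F
      (𝓝 (-chordComp X Y (β + π / 2) b (b + q))) :=
    ((h.hasDerivAt_chordComp (β + π / 2) b).continuousAt.tendsto.mono_left
      (hF.trans nhdsWithin_le_nhds)).neg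
  have hθ : Tendsto (fun t => θ (t + q) - β) F (𝓝 0) := by
    have : Continuous fun t => θ (t + q) - β := by
      have := h.continuous
      fun_prop
    have h2 := (this.tendsto b).mono_left (hF.trans nhdsWithin_le_nhds)
    simpa [← hβ] using h2
  have hc : Tendsto (fun t => cos (θ (t + q) - β)) F (𝓝 1) := by
    simpa [Function.comp_def] using (continuous_cos.tendsto 0).comp hθ
  have hm : Tendsto (fun t => midAngle θ q (t + d) - midAngle θ q (b + d)) F (𝓝 0) := by
    have : Continuous fun t => midAngle θ q (t + d) - midAngle θ q (b + d) := by
      have := h.continuous_midAngle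
      fun_prop
    have h2 := (this.tendsto b).mono_left (hF.trans nhdsWithin_le_nhds)
    simpa using h2
  have key := le_of_tendsto_of_tendsto (hP.mul hc) ((hM.const_mul 2).mul hQ) ?_
  · rw [mul_one] at key
    have : 2 * (2 * sin (halfTurn θ q (b + d)) /
        chordComp X Y (midAngle θ q (b + d)) (b + d) (b + d + q)) *
        -chordComp X Y (β + π / 2) b (b + q) = 2 * (2 * -chordComp X Y (β + π / 2) b (b + q) *
        sin (halfTurn θ q (b + d))) /
        chordComp X Y (midAngle θ q (b + d)) (b + d) (b + d + q) := by ring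
    rw [this, le_div_iff₀ hapos] at key
    linarith
  · have hsmall : ∀ᶠ t in F, |midAngle θ q (t + d) - midAngle θ q (b + d)| < π / 4 := by
      have := hm.abs
      rw [abs_zero] at this
      exact this.eventually (gt_mem_nhds (by positivity))
    filter_upwards [hsign, hturn, hsmall, hF self_mem_nhdsWithin,
      hQ.eventually (lt_mem_nhds (by linarith : 0 < -chordComp X Y (β + π / 2) b (b + q)))]
      with t h1 h2 h3 h4 h5
    have hne : t - b ≠ 0 := sub_ne_zero.2 h4
    have hε : 0 ≤ (θ (t + q) - β) * (t - b) := by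
      rcases le_total t b with htb | htb
      · have := h.monotone (by linarith : t + q ≤ b + q)
        exact mul_nonneg_of_nonpos_of_nonpos (by linarith) (by linarith)
      · have := h.monotone (by linarith : b + q ≤ t + q)
        exact mul_nonneg (by linarith) (by linarith)
    have h6 := sin_div_le_two_mul_sin_div hne hε h2 h3
    have h7 := mul_le_mul_of_nonneg_right h6 h5.le
    rw [Function.comp_apply, show t + d - (b + d) = t - b by ring]
    refine le_trans ?_ h7
    rw [slope_def_field, h0]
    rw [chordComp_rotate X Y β] at h1
    have hsq : 0 < (t - b) ^ 2 := by positivity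
    generalize chordComp X Y (β + π / 2) t (t + q) = Q at h1
    generalize chordComp X Y β t (t + q) = P at h1
    rw [← sub_nonpos]
    have : (P - 0) / (t - b) * cos (θ (t + q) - β) - sin (θ (t + q) - β) / (t - b) * -Q =
        ((cos (θ (t + q) - β) * P + sin (θ (t + q) - β) * Q) * (t - b)) / (t - b) ^ 2 := by
      field_simp
      ring
    rw [this]
    exact div_nonpos_of_nonpos_of_nonneg h1 hsq.le

/-- The chord of an arc with antiparallel end tangents is nondegenerate. -/
lemma chordComp_neg_of_antiparallel (h : IsConvexCurve_s14 X Y θ q) {b : ℝ}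
    (hb : θ (b + q) = θ b + π) : chordComp X Y (θ (b + q) + π / 2) b (b + q) < 0 := by
  have hq := h.pos
  have hpi := pi_pos
  have ivt := intermediate_value_Icc (by linarith : b ≤ b + q) h.continuous.continuousOn
  obtain ⟨t₁, ht₁, e₁⟩ := ivt (show θ b + π / 6 ∈ Set.Icc _ _ from ⟨by linarith, by linarith⟩)
  obtain ⟨t₂, ht₂, e₂⟩ := ivt (show θ b + π / 2 ∈ Set.Icc _ _ from ⟨by linarith, by linarith⟩)
  have hlt : t₁ < t₂ := by
    by_contra! hcon
    have := h.monotone hcon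
    linarith
  have hsin : ∀ x, cos (x - (θ (b + q) + π / 2)) = -sin (x - θ b) := fun x => by
    rw [hb, ← sub_sub, cos_sub_pi_div_two, ← sub_sub, sin_sub_pi]
  have hle : ∀ t ∈ Set.Icc b (b + q), cos (θ t - (θ (b + q) + π / 2)) ≤ 0 := fun t ht => by
    have := h.monotone ht.1
    have := h.monotone ht.2
    rw [hsin, neg_nonpos]
    exact sin_nonneg_of_nonneg_of_le_pi (by linarith) (by linarith)
  have p1 := h.chordComp_le ht₁.1 fun t ht => hle t ⟨ht.1, ht.2.trans ht₁.2⟩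
  have p3 := h.chordComp_le ht₂.2 fun t ht => hle t ⟨ht₂.1.trans ht.1, ht.2⟩
  have p2 := h.chordComp_le (μ := θ (b + q) + π / 2) (κ := -(1 / 2)) hlt.le fun t ht => by
    have := h.monotone ht.1
    have := h.monotone ht.2
    rw [hsin, neg_le_neg_iff, ← sin_pi_div_six]
    exact sin_le_sin_of_le_of_le_pi_div_two (by linarith) (by linarith) (by linarith)
  rw [← chordComp_trans X Y _ b t₁, ← chordComp_trans X Y _ t₁ t₂]
  linarith

/-- The length of the chord cannot reach a critical value from below on the right or from above
on the left at an arc with antiparallel end tangents. -/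
lemma not_antiparallel (h : IsConvexCurve_s14 X Y θ q)
    (hA : HasBisectingChords X Y θ q) {b : ℝ} {F : Filter ℝ} [F.NeBot] (hF : F ≤ 𝓝[≠] b)
    (hb : θ (b + q) = θ b + π)
    (h0 : chordComp X Y (θ (b + q)) b (b + q) = 0)
    (hK : ∀ᶠ s in F, θ (s + q) = θ s + π)
    (hsign : ∀ᶠ s in F, chordComp X Y (θ (s + q)) s (s + q) * (s - b) ≤ 0) : False := by
  have hq := h.pos
  set β := θ (b + q) with hβ
  have e2 : b + q + q = b + 2 * q := by ring
  have e3 : b + 2 * q + q = b + 3 * q := by ring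
  have e4 : b + 3 * q + q = b + 4 * q := by ring
  have m12 := h.monotone (by linarith : b + q ≤ b + 2 * q)
  have m23 := h.monotone (by linarith : b + 2 * q ≤ b + 3 * q)
  have m34 := h.monotone (by linarith : b + 3 * q ≤ b + 4 * q)
  have hb4 : θ (b + 4 * q) = β + π := by rw [h.turning, hb]; ring
  -- the chord is positive, and at most `q`
  have hrle : -chordComp X Y (β + π / 2) b (b + q) ≤ q :=
    (neg_le_abs _).trans (h.abs_chordComp_le _ _)
  have cl : ∀ μ, chordComp X Y μ b (b + q) + (chordComp X Y μ (b + q) (b + 2 * q) +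
      (chordComp X Y μ (b + 2 * q) (b + 3 * q) + chordComp X Y μ (b + 3 * q) (b + 4 * q))) = 0 :=
    fun μ => by rw [chordComp_trans, chordComp_trans, chordComp_trans, h.chordComp_period]
  have bd : ∀ μ s t, t = s + q → |chordComp X Y μ s t| ≤ q := by
    rintro μ s t rfl; exact h.abs_chordComp_le μ s
  have hu : halfTurn θ q (b + q) < π / 2 := by
    by_contra! hcon
    unfold halfTurn at hcon
    rw [e2] at hcon
    have hconst : ∀ t ∈ Set.Icc (b + 2 * q) (b + 4 * q), cos (θ t - β) ≤ -1 := by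
      intro t ht
      have := h.monotone ht.1
      have := h.monotone ht.2
      rw [show θ t = β + π by linarith, add_sub_cancel_left, cos_pi]
    have := h.chordComp_le (by linarith) hconst
    have := cl β
    rw [chordComp_trans] at this
    linarith [abs_le.1 (bd β (b + q) (b + 2 * q) e2.symm)]
  have hv : halfTurn θ q (b + 3 * q) < π / 2 := by
    by_contra! hcon
    unfold halfTurn at hcon
    rw [e4] at hcon
    have hconst : ∀ t ∈ Set.Icc (b + q) (b + 3 * q), 1 ≤ cos (θ t - β) := by
      intro t ht
      have := h.monotone ht.1
      have := h.monotone ht.2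
      rw [show θ t = β by linarith, sub_self, cos_zero]
    have := h.le_chordComp (by linarith) hconst
    have := cl β
    rw [← add_assoc (chordComp X Y β (b + q) (b + 2 * q)), chordComp_trans] at this
    linarith [abs_le.1 (bd β (b + 3 * q) (b + 4 * q) e4.symm)]
  set u := halfTurn θ q (b + q) with hudef
  set v := halfTurn θ q (b + 3 * q) with hvdef
  have hu0 : 0 ≤ u := h.halfTurn_nonneg _
  have hv0 : 0 ≤ v := h.halfTurn_nonneg _
  have hu2 : θ (b + 2 * q) = β + 2 * u := by
    rw [hudef]; unfold halfTurn; rw [e2, ← hβ]; ring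
  have hv2 : θ (b + 3 * q) = β + π - 2 * v := by
    rw [hvdef]; unfold halfTurn; rw [e4, hb4]; ring
  have hmu : midAngle θ q (b + q) = β + u := by
    unfold midAngle; rw [e2, hu2, ← hβ]; ring
  have hmv : midAngle θ q (b + 3 * q) = β + π - v := by
    unfold midAngle; rw [e4, hb4, hv2]; ring
  have huv : u + v ≤ π / 2 := by linarith
  have hcu : 0 < cos u := cos_pos_of_mem_Ioo ⟨by linarith [pi_pos], hu⟩
  have hcv : 0 < cos v := cos_pos_of_mem_Ioo ⟨by linarith [pi_pos], hv⟩
  have hsu : 0 ≤ sin u := sin_nonneg_of_nonneg_of_le_pi hu0 (by linarith)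
  have hsv : 0 ≤ sin v := sin_nonneg_of_nonneg_of_le_pi hv0 (by linarith)
  -- the drops along the three other arcs
  have a1 := h.le_chordComp_midAngle (s := b + q)
  have a3 := h.le_chordComp_midAngle (s := b + 3 * q)
  rw [← hudef, hmu] at a1
  rw [← hvdef, hmv] at a3
  have z1 := h.chordComp_eq_zero hA (s := b + q) hu.ne
  have z3 := h.chordComp_eq_zero hA (s := b + 3 * q) hv.ne
  rw [hmu] at z1
  rw [hmv] at z3
  have d1 : chordComp X Y (β + π / 2) (b + q) (b + q + q) =
      sin u * chordComp X Y (β + u) (b + q) (b + q + q) := by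
    rw [chordComp_rotate X Y (β + u), z1, mul_zero, add_zero,
      show β + π / 2 - (β + u) = π / 2 - u by ring, cos_pi_div_two_sub]
  have d3 : chordComp X Y (β + π / 2) (b + 3 * q) (b + 3 * q + q) =
      sin v * chordComp X Y (β + π - v) (b + 3 * q) (b + 3 * q + q) := by
    rw [chordComp_rotate X Y (β + π - v), z3, mul_zero, add_zero,
      show β + π / 2 - (β + π - v) = -(π / 2 - v) by ring, cos_neg, cos_pi_div_two_sub]
  have d1' : q * (sin u * cos u) ≤ chordComp X Y (β + π / 2) (b + q) (b + q + q) := by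
    rw [d1]; nlinarith
  have d3' : q * (sin v * cos v) ≤ chordComp X Y (β + π / 2) (b + 3 * q) (b + 3 * q + q) := by
    rw [d3]; nlinarith
  have d2 : min (sin (2 * u)) (sin (2 * v)) * q ≤
      chordComp X Y (β + π / 2) (b + 2 * q) (b + 3 * q) := by
    have := h.le_chordComp (μ := β + π / 2) (a := b + 2 * q) (b := b + 3 * q)
      (κ := min (sin (2 * u)) (sin (2 * v))) (by linarith) (fun t ht => by
        have h1 := h.monotone ht.1
        have h2 := h.monotone ht.2
        rw [← sub_sub, cos_sub_pi_div_two, min_le_iff]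
        rcases le_total (θ t - β) (π / 2) with h3 | h3
        · exact .inl (sin_le_sin_of_le_of_le_pi_div_two (by linarith) h3 (by linarith))
        · right
          rw [← sin_pi_sub (θ t - β)]
          exact sin_le_sin_of_le_of_le_pi_div_two (by linarith) (by linarith) (by linarith))
    linarith
  have total := cl (β + π / 2)
  rw [e2] at d1'
  rw [e4] at d3'
  have hr := h.chordComp_neg_of_antiparallel hb
  have r1 := h.chordComp_le_of_antiparallel hA hF hb h0 hr hsign (d := q) hu (by
    filter_upwards with s
    unfold midAngle
    rcases le_total s b with hsb | hsb
    · have := h.monotone (by linarith : s + q + q ≤ b + q + q)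
      exact mul_nonneg_of_nonpos_of_nonpos (by linarith) (by linarith)
    · have := h.monotone (by linarith : b + q + q ≤ s + q + q)
      exact mul_nonneg (by linarith) (by linarith))
  have r3 := h.chordComp_le_of_antiparallel hA hF hb h0 hr hsign (d := 3 * q) hv (by
    filter_upwards [hK] with s hs
    unfold midAngle
    rw [show s + 3 * q + q = s + 4 * q by ring, e4, h.turning, h.turning]
    rcases le_total s b with hsb | hsb
    · have := h.monotone (by linarith : s + 3 * q ≤ b + 3 * q)
      exact mul_nonneg_of_nonpos_of_nonpos (by linarith) (by linarith)
    · have := h.monotone (by linarith : b + 3 * q ≤ s + 3 * q)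
      exact mul_nonneg (by linarith) (by linarith))
  rw [← hudef, hmu] at r1
  rw [← hvdef, hmv] at r3
  have c1 : cos u ≤ 2 * sin u := by
    refine le_of_mul_le_mul_left ((a1.trans r1).trans ?_) hq
    linarith [mul_le_mul_of_nonneg_right hrle hsu]
  have c3 : cos v ≤ 2 * sin v := by
    refine le_of_mul_le_mul_left ((a3.trans r3).trans ?_) hq
    linarith [mul_le_mul_of_nonneg_right hrle hsv]
  have f1 := two_fifths_le_sin_mul_cos hu0 hv0 huv c1 c3
  have f3 := two_fifths_le_sin_mul_cos hv0 hu0 (by linarith) c3 c1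
  have fm : 4 / 5 ≤ min (sin (2 * u)) (sin (2 * v)) := by
    rw [le_min_iff, sin_two_mul, sin_two_mul]; constructor <;> linarith
  have g1 := mul_le_mul_of_nonneg_left f1 hq.le
  have g3 := mul_le_mul_of_nonneg_left f3 hq.le
  have g2 := mul_le_mul_of_nonneg_right fm hq.le
  linarith

lemma halfTurn_eq_of_chordComp_ne_zero (h : IsConvexCurve_s14 X Y θ q)
    (hA : HasBisectingChords X Y θ q) {s : ℝ}
    (hs : chordComp X Y (midAngle θ q s + π / 2) s (s + q) ≠ 0) :
    halfTurn θ q s = π / 2 := by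
  by_contra hne
  exact hs (h.chordComp_eq_zero hA hne)

lemma midAngle_add_of_halfTurn {s : ℝ} (hs : halfTurn θ q s = π / 2) :
    θ (s + q) = θ s + π ∧ midAngle θ q s + π / 2 = θ (s + q) := by
  unfold halfTurn at hs
  unfold midAngle
  constructor <;> linarith

lemma exists_halfTurn_ne (h : IsConvexCurve_s14 X Y θ q) (s : ℝ) :
    ∃ t ∈ Set.Icc s (s + 4 * q), halfTurn θ q t ≠ π / 2 := by
  by_contra! hcon
  have hq := h.pos
  have h1 := hcon s ⟨le_rfl, by linarith⟩
  have h2 := hcon (s + q) ⟨by linarith, by linarith⟩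
  have h3 := hcon (s + q + q) ⟨by linarith, by linarith⟩
  unfold halfTurn at h1 h2 h3
  have h4 := h.monotone (by linarith : s + q + q + q ≤ s + 4 * q)
  linarith [h.turning s, pi_pos]

/-- Every chord bisects the angle between the tangents at its ends. -/
theorem chordComp_midAngle_eq_zero (h : IsConvexCurve_s14 X Y θ q)
    (hA : HasBisectingChords X Y θ q) (s : ℝ) :
    chordComp X Y (midAngle θ q s + π / 2) s (s + q) = 0 := by
  set g : ℝ → ℝ := fun s => chordComp X Y (midAngle θ q s + π / 2) s (s + q) with hg
  have hcont : Continuous g := by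
    have h1 := h.continuous_midAngle
    have h2 : Continuous X := continuous_iff_continuousAt.2 fun t =>
      (h.hasDerivAt_fst t).continuousAt
    have h3 : Continuous Y := continuous_iff_continuousAt.2 fun t =>
      (h.hasDerivAt_snd t).continuousAt
    rw [hg]; unfold chordComp; fun_prop
  -- an endpoint of an interval on which `g` does not vanish is impossible
  have main : ∀ (b : ℝ) (F : Filter ℝ) [F.NeBot], F ≤ 𝓝[≠] b → g b = 0 →
      (∀ᶠ t in F, g t * (t - b) < 0) → False := by
    intro b F _ hF hb hev
    have hturn : ∀ᶠ t in F, halfTurn θ q t = π / 2 := hev.mono fun t ht =>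
      h.halfTurn_eq_of_chordComp_ne_zero hA fun h0 => by simp [hg, h0] at ht
    have hbturn : halfTurn θ q b = π / 2 :=
      tendsto_nhds_unique ((h.continuous_halfTurn.tendsto b).mono_left
        (hF.trans nhdsWithin_le_nhds)) (tendsto_const_nhds.congr' (hturn.mono fun t ht => ht.symm))
    obtain ⟨e1, e2⟩ := midAngle_add_of_halfTurn hbturn
    refine h.not_antiparallel hA hF e1 (by rw [← e2]; exact hb)
      (hturn.mono fun t ht => (midAngle_add_of_halfTurn ht).1) ?_
    filter_upwards [hev, hturn] with t h1 h2
    rw [← (midAngle_add_of_halfTurn h2).2]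
    exact h1.le
  by_contra hs
  rcases lt_or_gt_of_ne hs with hneg | hpos
  · obtain ⟨t, ht, htne⟩ := h.exists_halfTurn_ne (s - 4 * q)
    rw [sub_add_cancel] at ht
    obtain ⟨b, ⟨hbI, hb0⟩, hbmax⟩ :=
      (isCompact_Icc.inter_right (isClosed_singleton.preimage hcont) :
        IsCompact (Set.Icc t s ∩ g ⁻¹' {0})).exists_isGreatest
        ⟨t, ⟨le_rfl, ht.2⟩, h.chordComp_eq_zero hA htne⟩
    have hbs : b < s := lt_of_le_of_ne hbI.2 fun e => hs (by subst e; exact hb0)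
    refine main b (𝓝[>] b) (nhdsWithin_mono _ fun x hx => ne_of_gt hx) hb0 ?_
    filter_upwards [Ioc_mem_nhdsGT hbs] with x hx
    refine mul_neg_of_neg_of_pos ?_ (sub_pos.2 hx.1)
    by_contra! hx0
    obtain ⟨y, hy, hy0⟩ := intermediate_value_Icc' hx.2 hcont.continuousOn ⟨hneg.le, hx0⟩
    exact (hx.1.trans_le hy.1).not_ge (hbmax ⟨⟨hbI.1.trans (hx.1.le.trans hy.1), hy.2⟩, hy0⟩)
  · obtain ⟨t, ht, htne⟩ := h.exists_halfTurn_ne s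
    obtain ⟨b, ⟨hbI, hb0⟩, hbmin⟩ :=
      (isCompact_Icc.inter_right (isClosed_singleton.preimage hcont) :
        IsCompact (Set.Icc s t ∩ g ⁻¹' {0})).exists_isLeast
        ⟨t, ⟨ht.1, le_rfl⟩, h.chordComp_eq_zero hA htne⟩
    have hbs : s < b := lt_of_le_of_ne hbI.1 fun e => hs (by subst e; exact hb0)
    refine main b (𝓝[<] b) (nhdsWithin_mono _ fun x hx => ne_of_lt hx) hb0 ?_
    filter_upwards [Ico_mem_nhdsLT hbs] with x hx
    refine mul_neg_of_pos_of_neg ?_ (sub_neg.2 hx.2)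
    by_contra! hx0
    obtain ⟨y, hy, hy0⟩ := intermediate_value_Icc' hx.1 hcont.continuousOn ⟨hx0, hpos.le⟩
    exact (hy.2.trans_lt hx.2).not_ge (hbmin ⟨⟨hy.1, hy.2.trans (hx.2.le.trans hbI.2)⟩, hy0⟩)

lemma chord_normSq_const (h : IsConvexCurve_s14 X Y θ q) (hA : HasBisectingChords X Y θ q) (s : ℝ) :
    (X (s + q) - X s) ^ 2 + (Y (s + q) - Y s) ^ 2 = (X q - X 0) ^ 2 + (Y q - Y 0) ^ 2 := by
  have hd : ∀ t, HasDerivAt (fun t => (X (t + q) - X t) ^ 2 + (Y (t + q) - Y t) ^ 2) 0 t := by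
    intro t
    have hx := (((h.hasDerivAt_fst (t + q)).comp_add_const t q).sub (h.hasDerivAt_fst t)).pow 2
    have hy := (((h.hasDerivAt_snd (t + q)).comp_add_const t q).sub (h.hasDerivAt_snd t)).pow 2
    refine (hx.add hy).congr_deriv ?_
    have h0 := h.chordComp_midAngle_eq_zero hA t
    have e1 : θ (t + q) = midAngle θ q t + halfTurn θ q t := by
      unfold midAngle halfTurn; ring
    have e2 : θ t = midAngle θ q t - halfTurn θ q t := by
      unfold midAngle halfTurn; ring
    unfold chordComp at h0
    rw [cos_add_pi_div_two, sin_add_pi_div_two] at h0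
    rw [e1, e2, sin_add, sin_sub, cos_add, cos_sub]
    simp only [Pi.sub_apply]
    push_cast
    linear_combination 4 * sin (halfTurn θ q t) * h0
  have := is_const_of_deriv_eq_zero (fun t => (hd t).differentiableAt) (fun t => (hd t).deriv) s 0
  simpa using this

/-- An arc whose end tangents agree is a segment. -/
lemma chord_eq_of_tangent_eq (h : IsConvexCurve_s14 X Y θ q) {s : ℝ}
    (hc : cos (θ (s + q)) = cos (θ s)) (hs : sin (θ (s + q)) = sin (θ s)) :
    X (s + q) - X s = q * cos (θ s) ∧ Y (s + q) - Y s = q * sin (θ s) := by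
  have hq := h.pos
  have hpi := pi_pos
  have hmono := h.monotone (by linarith : s ≤ s + q)
  have hturn := h.turning s
  have hone : cos (θ (s + q) - θ s) = 1 := by
    rw [cos_sub, hc, hs]; nlinarith [sin_sq_add_cos_sq (θ s)]
  have hle := h.monotone (by linarith : s + q ≤ s + 4 * q)
  have heq : θ (s + q) = θ s := by
    by_contra hne
    have h2 : θ (s + q) = θ s + 2 * π := by
      obtain ⟨n, hn⟩ := (cos_eq_one_iff _).1 hone
      have hlt : 0 < θ (s + q) - θ s := sub_pos.2 (lt_of_le_of_ne hmono (Ne.symm hne))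
      have hn1 : 0 < n := by
        by_contra! hcon
        have : (n : ℝ) ≤ 0 := by exact_mod_cast hcon
        nlinarith
      have : (1 : ℝ) ≤ n := by exact_mod_cast hn1
      nlinarith
    have hconst : ∀ t ∈ Set.Icc (s + q) (s + 4 * q), 1 ≤ cos (θ t - θ s) := by
      intro t ht
      have := h.monotone ht.1
      have := h.monotone ht.2
      rw [show θ t = θ s + 2 * π by linarith, add_sub_cancel_left, cos_two_pi]
    have h3 := h.le_chordComp (by linarith) hconst
    have h4 := h.chordComp_period (θ s) s
    rw [← chordComp_trans X Y _ s (s + q)] at h4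
    linarith [abs_le.1 (h.abs_chordComp_le (θ s) s)]
  have hθ : ∀ t ∈ Set.Icc s (s + q), θ t = θ s := fun t ht =>
    le_antisymm ((h.monotone ht.2).trans heq.le) (h.monotone ht.1)
  have key : ∀ μ, chordComp X Y μ s (s + q) = cos (θ s - μ) * q := fun μ => by
    have h1 := h.le_chordComp (μ := μ) (κ := cos (θ s - μ)) (by linarith : s ≤ s + q)
      fun t ht => by rw [hθ t ht]
    have h2 := h.chordComp_le (μ := μ) (κ := cos (θ s - μ)) (by linarith : s ≤ s + q)
      fun t ht => by rw [hθ t ht]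
    linarith
  have k1 := key 0
  have k2 := key (π / 2)
  unfold chordComp at k1 k2
  rw [cos_sub_pi_div_two] at k2
  simp only [cos_zero, sin_zero, sub_zero, cos_pi_div_two, sin_pi_div_two] at k1 k2
  constructor <;> linarith

end IsConvexCurve_s14

lemma eq_zero_of_sq_add_sq_eq_zero {a b : ℝ} (h : a ^ 2 + b ^ 2 = 0) : a = 0 ∧ b = 0 :=
  ⟨pow_eq_zero_iff two_ne_zero |>.1 (by linarith [sq_nonneg a, sq_nonneg b]),
    pow_eq_zero_iff two_ne_zero |>.1 (by linarith [sq_nonneg a, sq_nonneg b])⟩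

/-- Four unit vectors with `e₀ + e₂ = e₁ + e₃` have zero sum or coincide in pairs. -/
lemma unit_sum_cases {a₀ b₀ a₁ b₁ a₂ b₂ a₃ b₃ : ℝ} (h₀ : a₀ ^ 2 + b₀ ^ 2 = 1)
    (h₁ : a₁ ^ 2 + b₁ ^ 2 = 1) (h₂ : a₂ ^ 2 + b₂ ^ 2 = 1) (h₃ : a₃ ^ 2 + b₃ ^ 2 = 1)
    (ha : a₀ + a₂ = a₁ + a₃) (hb : b₀ + b₂ = b₁ + b₃) :
    (a₂ = -a₀ ∧ b₂ = -b₀) ∨ (a₁ = a₀ ∧ b₁ = b₀ ∧ a₃ = a₂ ∧ b₃ = b₂) ∨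
      (a₂ = a₁ ∧ b₂ = b₁ ∧ a₃ = a₀ ∧ b₃ = b₀) := by
  obtain rfl : a₃ = a₀ + a₂ - a₁ := by linarith
  obtain rfl : b₃ = b₀ + b₂ - b₁ := by linarith
  by_cases hS : a₂ = -a₀ ∧ b₂ = -b₀
  · exact .inl hS
  right
  have hSpos : 0 < (a₀ + a₂) ^ 2 + (b₀ + b₂) ^ 2 := by
    by_contra! hcon
    obtain ⟨h1, h2⟩ := eq_zero_of_sq_add_sq_eq_zero (hcon.antisymm (by positivity))
    exact hS ⟨by linarith, by linarith⟩
  -- `e₁ - e₀` and `e₁ - e₂` are orthogonal to the sum, hence parallel, and to each other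
  have o1 : (a₀ + a₂) * (a₁ - a₀) + (b₀ + b₂) * (b₁ - b₀) = 0 := by linarith
  have o2 : (a₀ + a₂) * (a₁ - a₂) + (b₀ + b₂) * (b₁ - b₂) = 0 := by linarith
  have horth : (a₁ - a₀) * (a₁ - a₂) + (b₁ - b₀) * (b₁ - b₂) = 0 := by linarith
  have hdet : (a₁ - a₀) * (b₁ - b₂) - (b₁ - b₀) * (a₁ - a₂) = 0 := by
    refine (mul_eq_zero.1 ?_).resolve_left hSpos.ne'
    linear_combination ((a₀ + a₂) * (b₁ - b₂) - (b₀ + b₂) * (a₁ - a₂)) * o1 +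
      ((b₀ + b₂) * (a₁ - a₀) - (a₀ + a₂) * (b₁ - b₀)) * o2
  have hprod : ((a₁ - a₀) ^ 2 + (b₁ - b₀) ^ 2) * ((a₁ - a₂) ^ 2 + (b₁ - b₂) ^ 2) = 0 := by
    linear_combination ((a₁ - a₀) * (a₁ - a₂) + (b₁ - b₀) * (b₁ - b₂)) * horth +
      ((a₁ - a₀) * (b₁ - b₂) - (b₁ - b₀) * (a₁ - a₂)) * hdet
  rcases mul_eq_zero.1 hprod with h | h
  · left
    obtain ⟨h1, h2⟩ := eq_zero_of_sq_add_sq_eq_zero h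
    refine ⟨?_, ?_, ?_, ?_⟩ <;> linarith
  · right
    obtain ⟨h1, h2⟩ := eq_zero_of_sq_add_sq_eq_zero h
    refine ⟨?_, ?_, ?_, ?_⟩ <;> linarith

/-- A quadrilateral with equal sides and distinct opposite vertices is a parallelogram. -/
lemma parallelogram_of_equal_sides {x₀ y₀ x₁ y₁ x₂ y₂ x₃ y₃ k : ℝ}
    (h₀ : (x₁ - x₀) ^ 2 + (y₁ - y₀) ^ 2 = k) (h₁ : (x₂ - x₁) ^ 2 + (y₂ - y₁) ^ 2 = k)
    (h₂ : (x₃ - x₂) ^ 2 + (y₃ - y₂) ^ 2 = k) (h₃ : (x₀ - x₃) ^ 2 + (y₀ - y₃) ^ 2 = k)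
    (h02 : 0 < (x₂ - x₀) ^ 2 + (y₂ - y₀) ^ 2) (h13 : 0 < (x₃ - x₁) ^ 2 + (y₃ - y₁) ^ 2) :
    x₀ + x₂ = x₁ + x₃ ∧ y₀ + y₂ = y₁ + y₃ := by
  have o0 : (x₂ - x₀) * (x₃ - x₁) + (y₂ - y₀) * (y₃ - y₁) = 0 := by linarith
  have o1 : (x₂ - x₀) * (x₀ + x₂ - x₁ - x₃) + (y₂ - y₀) * (y₀ + y₂ - y₁ - y₃) = 0 := by linarith
  have o2 : (x₃ - x₁) * (x₀ + x₂ - x₁ - x₃) + (y₃ - y₁) * (y₀ + y₂ - y₁ - y₃) = 0 := by linarith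
  generalize hu : x₂ - x₀ = u at *
  generalize hv : y₂ - y₀ = v at *
  generalize hp : x₃ - x₁ = p at *
  generalize hr : y₃ - y₁ = r at *
  generalize hw : x₀ + x₂ - x₁ - x₃ = w at *
  generalize hz : y₀ + y₂ - y₁ - y₃ = z at *
  have hdet : (u * r - v * p) ^ 2 = (u ^ 2 + v ^ 2) * (p ^ 2 + r ^ 2) := by
    linear_combination (-(u * p + v * r)) * o0
  have hne : u * r - v * p ≠ 0 := fun h => by
    rw [h] at hdet
    have := mul_pos h02 h13
    linarith
  have hw0 : w = 0 := by
    refine (mul_eq_zero.1 (?_ : (u * r - v * p) * w = 0)).resolve_left hne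
    linear_combination r * o1 - v * o2
  have hz0 : z = 0 := by
    refine (mul_eq_zero.1 (?_ : (u * r - v * p) * z = 0)).resolve_left hne
    linear_combination u * o2 - p * o1
  constructor <;> linarith

namespace IsConvexCurve_s14

variable {X Y θ : ℝ → ℝ} {q : ℝ}

lemma inscribed_parallelogram (h : IsConvexCurve_s14 X Y θ q) (hA : HasBisectingChords X Y θ q)
    (hinj : ∀ s, 0 < (X (s + 2 * q) - X s) ^ 2 + (Y (s + 2 * q) - Y s) ^ 2) (s : ℝ) :
    X s + X (s + 2 * q) = X (s + q) + X (s + 3 * q) ∧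
      Y s + Y (s + 2 * q) = Y (s + q) + Y (s + 3 * q) := by
  have k0 := h.chord_normSq_const hA s
  have k1 := h.chord_normSq_const hA (s + q)
  have k2 := h.chord_normSq_const hA (s + 2 * q)
  have k3 := h.chord_normSq_const hA (s + 3 * q)
  have i1 := hinj (s + q)
  rw [show s + q + q = s + 2 * q by ring] at k1
  rw [show s + 2 * q + q = s + 3 * q by ring] at k2
  rw [show s + 3 * q + q = s + 4 * q by ring, h.periodic_fst, h.periodic_snd] at k3
  rw [show s + q + 2 * q = s + 3 * q by ring] at i1
  exact parallelogram_of_equal_sides k0 k1 k2 k3 (hinj s) i1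

/-- The tangents half a perimeter apart are antiparallel. -/
lemma tangent_add_two_mul (h : IsConvexCurve_s14 X Y θ q) (hA : HasBisectingChords X Y θ q)
    (hinj : ∀ s, 0 < (X (s + 2 * q) - X s) ^ 2 + (Y (s + 2 * q) - Y s) ^ 2) (s : ℝ) :
    cos (θ (s + 2 * q)) = -cos (θ s) ∧ sin (θ (s + 2 * q)) = -sin (θ s) := by
  have hq := h.pos
  have hpar := h.inscribed_parallelogram hA hinj
  have e2 : s + q + q = s + 2 * q := by ring
  have e3 : s + 2 * q + q = s + 3 * q := by ring
  have e4 : s + 3 * q + q = s + 4 * q := by ring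
  have hcos : cos (θ s) + cos (θ (s + 2 * q)) = cos (θ (s + q)) + cos (θ (s + 3 * q)) := by
    have hd := ((h.hasDerivAt_fst s).add ((h.hasDerivAt_fst (s + 2 * q)).comp_add_const s (2 * q)))
    have hd' := (((h.hasDerivAt_fst (s + q)).comp_add_const s q).add
      ((h.hasDerivAt_fst (s + 3 * q)).comp_add_const s (3 * q)))
    exact hd.unique (hd'.congr_of_eventuallyEq (.of_forall fun t => (hpar t).1))
  have hsin : sin (θ s) + sin (θ (s + 2 * q)) = sin (θ (s + q)) + sin (θ (s + 3 * q)) := by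
    have hd := ((h.hasDerivAt_snd s).add ((h.hasDerivAt_snd (s + 2 * q)).comp_add_const s (2 * q)))
    have hd' := (((h.hasDerivAt_snd (s + q)).comp_add_const s q).add
      ((h.hasDerivAt_snd (s + 3 * q)).comp_add_const s (3 * q)))
    exact hd.unique (hd'.congr_of_eventuallyEq (.of_forall fun t => (hpar t).2))
  obtain ⟨hx, hy⟩ := hpar s
  have c4 : cos (θ (s + 4 * q)) = cos (θ s) := by rw [h.turning, cos_add_two_pi]
  have s4 : sin (θ (s + 4 * q)) = sin (θ s) := by rw [h.turning, sin_add_two_pi]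
  rcases unit_sum_cases (cos_sq_add_sin_sq (θ s)) (cos_sq_add_sin_sq (θ (s + q)))
    (cos_sq_add_sin_sq (θ (s + 2 * q))) (cos_sq_add_sin_sq (θ (s + 3 * q))) hcos hsin with
    hc | ⟨g1, g2, g3, g4⟩ | ⟨g1, g2, g3, g4⟩
  · exact hc
  · obtain ⟨x0, y0⟩ := h.chord_eq_of_tangent_eq g1 g2
    obtain ⟨x2, y2⟩ := h.chord_eq_of_tangent_eq (s := s + 2 * q) (by rw [e3, g3]) (by rw [e3, g4])
    rw [e3] at x2 y2
    constructor <;> refine mul_left_cancel₀ hq.ne' ?_ <;> linarith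
  · obtain ⟨x1, y1⟩ := h.chord_eq_of_tangent_eq (s := s + q) (by rw [e2, g1]) (by rw [e2, g2])
    obtain ⟨x3, y3⟩ := h.chord_eq_of_tangent_eq (s := s + 3 * q) (by rw [e4, g3, c4])
      (by rw [e4, g4, s4])
    rw [e4, h.periodic_fst, g3] at x3
    rw [e4, h.periodic_snd, g4] at y3
    rw [e2] at x1 y1
    rw [g1, g2]
    constructor <;> refine mul_left_cancel₀ hq.ne' ?_ <;> linarith

/-- A convex curve without opposite double points, whose quarter chords all bisect the angle of
their end tangents, is a circle. -/
theorem exists_circle (h : IsConvexCurve_s14 X Y θ q) (hA : HasBisectingChords X Y θ q)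
    (hinj : ∀ s, 0 < (X (s + 2 * q) - X s) ^ 2 + (Y (s + 2 * q) - Y s) ^ 2) :
    ∃ x y r : ℝ, 0 < r ∧ ∀ s, (X s - x) ^ 2 + (Y s - y) ^ 2 = r ^ 2 := by
  have hq := h.pos
  have htan := h.tangent_add_two_mul hA hinj
  obtain ⟨x, hx⟩ : ∃ x, ∀ s, X (s + 2 * q) - x = -(X s - x) := by
    have hd : ∀ s, HasDerivAt (fun s => X s + X (s + 2 * q)) 0 s := fun s =>
      ((h.hasDerivAt_fst s).add
        ((h.hasDerivAt_fst (s + 2 * q)).comp_add_const s (2 * q))).congr_deriv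
        (by rw [(htan s).1]; ring)
    refine ⟨(X 0 + X (0 + 2 * q)) / 2, fun s => ?_⟩
    have := is_const_of_deriv_eq_zero (fun t => (hd t).differentiableAt)
      (fun t => (hd t).deriv) s 0
    linarith
  obtain ⟨y, hy⟩ : ∃ y, ∀ s, Y (s + 2 * q) - y = -(Y s - y) := by
    have hd : ∀ s, HasDerivAt (fun s => Y s + Y (s + 2 * q)) 0 s := fun s =>
      ((h.hasDerivAt_snd s).add
        ((h.hasDerivAt_snd (s + 2 * q)).comp_add_const s (2 * q))).congr_deriv
        (by rw [(htan s).2]; ring)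
    refine ⟨(Y 0 + Y (0 + 2 * q)) / 2, fun s => ?_⟩
    have := is_const_of_deriv_eq_zero (fun t => (hd t).differentiableAt)
      (fun t => (hd t).deriv) s 0
    linarith
  obtain ⟨k, hk⟩ : ∃ k, ∀ s, (X (s + q) - X s) ^ 2 + (Y (s + q) - Y s) ^ 2 = k :=
    ⟨_, h.chord_normSq_const hA⟩
  set f : ℝ → ℝ := fun s => (X s - x) ^ 2 + (Y s - y) ^ 2 with hf
  -- the half diagonals of the inscribed rhombi
  have horth : ∀ s, (X s - x) * (X (s + q) - x) + (Y s - y) * (Y (s + q) - y) = 0 := fun s => by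
    have h1 := hk s
    have h2 := hk (s + q)
    rw [show s + q + q = s + 2 * q by ring] at h2
    linear_combination (h2 - h1) / 4 -
      (X (s + 2 * q) - x - (X s - x) - 2 * (X (s + q) - x)) / 4 * hx s -
      (Y (s + 2 * q) - y - (Y s - y) - 2 * (Y (s + q) - y)) / 4 * hy s
  have hsum : ∀ s, f s + f (s + q) = k := fun s => by
    simp only [hf]
    linear_combination hk s + 2 * horth s
  have hpos : ∀ s, 0 < f s := fun s => by
    have h1 := hinj s
    have h2 := hx s
    have h3 := hy s
    simp only [hf]
    have e1 : X (s + 2 * q) - X s = -2 * (X s - x) := by linarith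
    have e2 : Y (s + 2 * q) - Y s = -2 * (Y s - y) := by linarith
    rw [e1, e2] at h1
    linarith
  have hfd : ∀ s, HasDerivAt f (2 * ((X s - x) * cos (θ s) + (Y s - y) * sin (θ s))) s :=
    fun s => by
    refine ((((h.hasDerivAt_fst s).sub_const x).pow 2).add
      (((h.hasDerivAt_snd s).sub_const y).pow 2)).congr_deriv ?_
    push_cast
    ring
  have hfcont : Continuous f := continuous_iff_continuousAt.2 fun t => (hfd t).continuousAt
  have hfper : Function.Periodic f (4 * q) := fun s => by
    simp only [hf, h.periodic_fst, h.periodic_snd]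
  obtain ⟨s, -, hs⟩ := isCompact_Icc.exists_isMaxOn (s := Set.Icc 0 (4 * q))
    ⟨0, ⟨le_rfl, by linarith⟩⟩ hfcont.continuousOn
  have hmax : ∀ t, f t ≤ f s := fun t => by
    obtain ⟨t', ht', e⟩ := hfper.exists_mem_Ico₀ (by linarith) t
    rw [e]
    exact hs ⟨ht'.1, ht'.2.le⟩
  have hmin : ∀ t, f (s + q) ≤ f t := fun t => by
    linarith [hsum s, hsum t, hmax (t + q)]
  have d0 := (IsLocalMax.hasDerivAt_eq_zero (Eventually.of_forall hmax) (hfd s))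
  have d1 := (IsLocalMin.hasDerivAt_eq_zero (Eventually.of_forall hmin) (hfd (s + q)))
  have d2 : cos (θ s) * (X (s + q) - x) + (X s - x) * cos (θ (s + q)) +
      (sin (θ s) * (Y (s + q) - y) + (Y s - y) * sin (θ (s + q))) = 0 := by
    have hd := ((((h.hasDerivAt_fst s).sub_const x).mul
      (((h.hasDerivAt_fst (s + q)).comp_add_const s q).sub_const x)).add
      (((h.hasDerivAt_snd s).sub_const y).mul
      (((h.hasDerivAt_snd (s + q)).comp_add_const s q).sub_const y)))
    exact hd.unique ((hasDerivAt_const s (0 : ℝ)).congr_of_eventuallyEq (.of_forall horth))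
  have heq : f s = f (s + q) := by
    have p0 := hpos s
    have p1 := hpos (s + q)
    have o := horth s
    have u0 := cos_sq_add_sin_sq (θ s)
    have u1 := cos_sq_add_sin_sq (θ (s + q))
    simp only [hf] at p0 p1 ⊢
    generalize X s - x = a at *
    generalize Y s - y = b at *
    generalize X (s + q) - x = a' at *
    generalize Y (s + q) - y = b' at *
    generalize cos (θ s) = c at *
    generalize sin (θ s) = d at *
    generalize cos (θ (s + q)) = c' at *
    generalize sin (θ (s + q)) = d' at *
    have e0 : c * b' - d * a' = 0 := by
      refine (mul_eq_zero.1 ?_).resolve_left p0.ne'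
      linear_combination (a * b' - b * a') / 2 * d0 + (b * c - a * d) * o
    have e1 : c' * b - d' * a = 0 := by
      refine (mul_eq_zero.1 ?_).resolve_left p1.ne'
      linear_combination (a' * b - b' * a) / 2 * d1 + (b' * c' - a' * d') * o
    have s0 : (c * a' + d * b') ^ 2 = a' ^ 2 + b' ^ 2 := by
      linear_combination (a' ^ 2 + b' ^ 2) * u0 - (c * b' - d * a') * e0
    have s1 : (a * c' + b * d') ^ 2 = a ^ 2 + b ^ 2 := by
      linear_combination (a ^ 2 + b ^ 2) * u1 - (c' * b - d' * a) * e1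
    linear_combination s0 - s1 - (c * a' + d * b' - (a * c' + b * d')) * d2
  refine ⟨x, y, √(f s), sqrt_pos.2 (hpos s), fun t => ?_⟩
  rw [sq_sqrt (hpos s).le]
  exact le_antisymm (hmax t) (heq.le.trans (hmin t))

end IsConvexCurve_s14

/-- A nowhere vanishing `C¹` curve in the plane has a differentiable logarithm. -/
lemma exists_hasDerivAt_log {z z' : ℝ → ℂ} (hz : ∀ s, HasDerivAt z (z' s) s)
    (hz' : Continuous z') (h0 : ∀ s, z s ≠ 0) :
    ∃ w : ℝ → ℂ, (∀ s, HasDerivAt w (z' s / z s) s) ∧ ∀ s, Complex.exp (w s) = z s := by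
  have hzc : Continuous z := continuous_iff_continuousAt.2 fun s => (hz s).continuousAt
  have hc : Continuous fun s => z' s / z s := hz'.div hzc h0
  have hw : ∀ s, HasDerivAt (fun s => Complex.log (z 0) + ∫ t in (0 : ℝ)..s, z' t / z t)
      (z' s / z s) s := fun s =>
    (intervalIntegral.integral_hasDerivAt_right (hc.intervalIntegrable _ _)
      (hc.stronglyMeasurableAtFilter _ _) hc.continuousAt).const_add _
  refine ⟨_, hw, fun s => ?_⟩
  have hd : ∀ t, HasDerivAt (fun s => Complex.exp
      (Complex.log (z 0) + ∫ t in (0 : ℝ)..s, z' t / z t) / z s) 0 t := fun t => by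
    refine ((hw t).cexp.div (hz t) (h0 t)).congr_deriv ?_
    rw [div_eq_zero_iff]
    left
    field_simp [h0 t]
    ring
  have := is_const_of_deriv_eq_zero (fun t => (hd t).differentiableAt)
    (fun t => (hd t).deriv) s 0
  rw [intervalIntegral.integral_same, add_zero, Complex.exp_log (h0 0), div_self (h0 0),
    div_eq_one_iff_eq (h0 s)] at this
  exact this

/-- The tangent angle of a curve lying to the left of its tangents is nondecreasing. -/
lemma monotone_of_support {X Y θ : ℝ → ℝ} (hX : ∀ s, HasDerivAt X (cos (θ s)) s)
    (hY : ∀ s, HasDerivAt Y (sin (θ s)) s) (hθ : Continuous θ)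
    (hsup : ∀ s t, 0 ≤ cos (θ s) * (Y t - Y s) - sin (θ s) * (X t - X s)) : Monotone θ := by
  have hloc : ∀ x, ∀ᶠ t in 𝓝[>] x, θ x ≤ θ t := fun x => by
    have hpi := pi_pos
    obtain ⟨ε, hε, hball⟩ := Metric.continuousAt_iff.1 hθ.continuousAt (π / 2) (by linarith)
    filter_upwards [Ioo_mem_nhdsGT (by linarith : x < x + ε)] with t ht
    have habs : ∀ u ∈ Set.Icc x t, -(π / 2) < θ u - θ x ∧ θ u - θ x < π / 2 := fun u hu => by
      refine abs_lt.1 (hball (x := u) ?_)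
      rw [Real.dist_eq, abs_lt]
      constructor <;> linarith [hu.1, hu.2, ht.2]
    have hg : ∀ u, HasDerivAt (fun u => cos (θ x) * X u + sin (θ x) * Y u)
        (cos (θ u - θ x)) u := fun u =>
      (((hX u).const_mul _).add ((hY u).const_mul _)).congr_deriv (by rw [cos_sub]; ring)
    have hmono := strictMonoOn_of_deriv_pos (convex_Icc x t)
      (fun u _ => (hg u).continuousAt.continuousWithinAt) (fun u hu => by
        rw [(hg u).deriv]
        exact cos_pos_of_mem_Ioo (habs u (interior_subset hu)))
    have hpos := hmono (Set.left_mem_Icc.2 ht.1.le) (Set.right_mem_Icc.2 ht.1.le) ht.1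
    obtain ⟨h1, h2⟩ := habs t (Set.right_mem_Icc.2 ht.1.le)
    by_contra! hlt
    have hcos := cos_pos_of_mem_Ioo ⟨h1, h2⟩
    have hsin : sin (θ t - θ x) < 0 := sin_neg_of_neg_of_neg_pi_lt (by linarith) (by linarith)
    have s1 := hsup x t
    have s2 := hsup t x
    have key : cos (θ t) * (Y x - Y t) - sin (θ t) * (X x - X t) =
        sin (θ t - θ x) * (cos (θ x) * X t + sin (θ x) * Y t -
          (cos (θ x) * X x + sin (θ x) * Y x)) -
        cos (θ t - θ x) * (cos (θ x) * (Y t - Y x) - sin (θ x) * (X t - X x)) := by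
      rw [sin_sub, cos_sub]
      linear_combination (sin (θ t) * (X x - X t) - cos (θ t) * (Y x - Y t)) *
        sin_sq_add_cos_sq (θ x)
    have := mul_nonneg hcos.le s1
    have := mul_neg_of_neg_of_pos hsin (sub_pos.2 hpos)
    linarith
  intro a b hab
  have hcl : IsClosed ({t | θ a ≤ θ t} ∩ Set.Icc a b) :=
    (isClosed_le continuous_const hθ).inter isClosed_Icc
  exact hcl.Icc_subset_of_forall_mem_nhdsWithin (le_refl (θ a))
    (fun x hx => (hloc x).mono fun t ht => le_trans hx.1 ht) (Set.right_mem_Icc.2 hab)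

/-- A simple closed curve with an interior point, lying to the left of its tangents, has a
tangent angle which makes it a convex curve. -/
theorem exists_isConvexCurve {X Y U V : ℝ → ℝ} {q x y : ℝ} (hq : 0 < q)
    (hX : ∀ s, HasDerivAt X (U s) s) (hY : ∀ s, HasDerivAt Y (V s) s)
    (hU : Continuous U) (hV : Continuous V) (hUV : ∀ s, U s ^ 2 + V s ^ 2 = 1)
    (pX : ∀ s, X (s + 4 * q) = X s) (pY : ∀ s, Y (s + 4 * q) = Y s)
    (hinj : ∀ s t, s < t → t < s + 4 * q → X t = X s → Y t ≠ Y s)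
    (hint : ∀ s, 0 < U s * (y - Y s) - V s * (x - X s))
    (hsup : ∀ s t, 0 ≤ U s * (Y t - Y s) - V s * (X t - X s)) :
    ∃ θ : ℝ → ℝ, IsConvexCurve_s14 X Y θ q ∧ (∀ s, cos (θ s) = U s) ∧ ∀ s, sin (θ s) = V s := by
  have pU : ∀ s, U (s + 4 * q) = U s := fun s =>
    (((hX (s + 4 * q)).comp_add_const s (4 * q)).congr_of_eventuallyEq
      (.of_forall fun t => (pX t).symm)).unique (hX s)
  have pV : ∀ s, V (s + 4 * q) = V s := fun s =>
    (((hY (s + 4 * q)).comp_add_const s (4 * q)).congr_of_eventuallyEq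
      (.of_forall fun t => (pY t).symm)).unique (hY s)
  set z : ℝ → ℂ := fun s => (X s - x : ℝ) + (Y s - y : ℝ) * Complex.I with hz
  set z' : ℝ → ℂ := fun s => (U s : ℝ) + (V s : ℝ) * Complex.I with hz'
  have zre : ∀ s, (z s).re = X s - x := fun s => by simp [hz]
  have zim : ∀ s, (z s).im = Y s - y := fun s => by simp [hz]
  have zre' : ∀ s, (z' s).re = U s := fun s => by simp [hz']
  have zim' : ∀ s, (z' s).im = V s := fun s => by simp [hz']
  have hzd : ∀ s, HasDerivAt z (z' s) s := fun s =>
    ((hX s).sub_const x).ofReal_comp.add ((((hY s).sub_const y).ofReal_comp).mul_const _)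
  have hzc' : Continuous z' := by fun_prop
  have hz0 : ∀ s, z s ≠ 0 := fun s h0 => by
    have h1 := hint s
    have h2 := zre s
    have h3 := zim s
    rw [h0, Complex.zero_re] at h2
    rw [h0, Complex.zero_im] at h3
    rw [show y - Y s = 0 by linarith, show x - X s = 0 by linarith] at h1
    simp at h1
  have hzc : Continuous z := continuous_iff_continuousAt.2 fun s => (hzd s).continuousAt
  have him : ∀ s, 0 < (z' s / z s).im := fun s => by
    rw [Complex.div_im, zre, zim, zre', zim', ← sub_div]
    refine div_pos ?_ (Complex.normSq_pos.2 (hz0 s))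
    linarith [hint s]
  obtain ⟨w, hw, hexp⟩ := exists_hasDerivAt_log hzd hzc' hz0
  have hψd : ∀ s, HasDerivAt (fun s => (w s).im) ((z' s / z s).im) s := fun s =>
    Complex.imCLM.hasFDerivAt.comp_hasDerivAt s (hw s)
  have hψc : Continuous fun s => (w s).im :=
    continuous_iff_continuousAt.2 fun s => (hψd s).continuousAt
  have hψm : StrictMono fun s => (w s).im := strictMono_of_deriv_pos fun s => by
    rw [(hψd s).deriv]
    exact him s
  have pz : ∀ s, z (s + 4 * q) = z s := fun s => by simp only [hz, pX, pY]
  have pz' : ∀ s, z' (s + 4 * q) = z' s := fun s => by simp only [hz', pU, pV]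
  have hturn : ∀ s, (w (s + 4 * q)).im = (w s).im + 2 * π := fun s => by
    have hpi := pi_pos
    obtain ⟨n, hn⟩ := Complex.exp_eq_exp_iff_exists_int.1
      (show Complex.exp (w (s + 4 * q)) = Complex.exp (w s) by rw [hexp, hexp, pz])
    have hn' : (w (s + 4 * q)).im = (w s).im + n * (2 * π) := by
      rw [hn]; simp
    have hlt : (w s).im < (w (s + 4 * q)).im := hψm (by linarith)
    have hn1 : 1 ≤ n := by
      by_contra! hcon
      have : (n : ℝ) ≤ 0 := by exact_mod_cast Int.lt_add_one_iff.1 hcon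
      nlinarith
    rcases hn1.eq_or_lt with rfl | hn2
    · simpa using hn'
    exfalso
    have hn2' : (2 : ℝ) ≤ n := by exact_mod_cast hn2
    have hlt2 : (w s).im + 2 * π < (w (s + 4 * q)).im := by nlinarith
    obtain ⟨t, ht, hte⟩ := intermediate_value_Ioo (by linarith : s ≤ s + 4 * q)
      hψc.continuousOn ⟨by linarith, hlt2⟩
    simp only at hte
    set l : ℝ := exp ((w t).re - (w s).re) with hl
    have hlpos : 0 < l := exp_pos _
    have hzt : z t = l * z s := by
      rw [← hexp, ← hexp, hl, Complex.ofReal_exp, ← Complex.exp_add]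
      rw [Complex.exp_eq_exp_iff_exists_int]
      refine ⟨1, Complex.ext ?_ ?_⟩ <;> simp [hte]
    have e1 : X t - x = l * (X s - x) := by rw [← zre, ← zre, hzt]; simp
    have e2 : Y t - y = l * (Y s - y) := by rw [← zim, ← zim, hzt]; simp
    have hl1 : l = 1 := by
      refine le_antisymm ?_ ?_ <;> by_contra! hcon
      · have h1 := hsup s t
        rw [show Y t - Y s = (l - 1) * (Y s - y) by linarith,
          show X t - X s = (l - 1) * (X s - x) by linarith] at h1
        have := mul_pos (sub_pos.2 hcon) (hint s)
        linarith
      · have h1 := mul_nonneg hlpos.le (hsup t s)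
        have := mul_pos (sub_pos.2 hcon) (hint t)
        have : l * (U t * (Y s - Y t) - V t * (X s - X t)) =
            -((1 - l) * (U t * (y - Y t) - V t * (x - X t))) := by
          linear_combination (-U t) * e2 + V t * e1
        linarith
    rw [hl1, one_mul] at e1 e2
    exact hinj s t ht.1 ht.2 (by linarith) (by linarith)
  have hexpθ : ∀ s, Complex.exp (((w s).im + (z' s / z s).arg : ℝ) * Complex.I) = z' s :=
    fun s => by
    have hn : ‖z' s‖ = 1 := by
      rw [← sq_eq_sq₀ (norm_nonneg _) zero_le_one, Complex.sq_norm, Complex.normSq_apply,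
        zre', zim']
      linarith [hUV s]
    have h1 := Complex.norm_mul_exp_arg_mul_I (z' s / z s)
    have h2 : z s = ‖z s‖ * Complex.exp ((w s).im * Complex.I) := by
      rw [← hexp, Complex.norm_exp, Complex.ofReal_exp, ← Complex.exp_add, Complex.re_add_im]
    have h3 : (‖z s‖ : ℂ) ≠ 0 := by simpa using hz0 s
    rw [norm_div, hn] at h1
    calc Complex.exp (((w s).im + (z' s / z s).arg : ℝ) * Complex.I)
        = ((1 / ‖z s‖ : ℝ) * Complex.exp ((z' s / z s).arg * Complex.I)) *
          (‖z s‖ * Complex.exp ((w s).im * Complex.I)) := by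
          rw [Complex.ofReal_add, add_mul, Complex.exp_add]
          push_cast
          field_simp
      _ = z' s := by rw [h1, ← h2, div_mul_cancel₀ _ (hz0 s)]
  have hθc : Continuous fun s => (w s).im + (z' s / z s).arg :=
    hψc.add (continuous_iff_continuousAt.2 fun s =>
      (Complex.continuousAt_arg (.inr (him s).ne')).comp (f := fun s => z' s / z s)
        (hzc'.div hzc hz0).continuousAt)
  have hcos : ∀ s, cos ((w s).im + (z' s / z s).arg) = U s := fun s => by
    have := congrArg Complex.re (hexpθ s)
    rwa [Complex.exp_ofReal_mul_I_re, zre'] at this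
  have hsin : ∀ s, sin ((w s).im + (z' s / z s).arg) = V s := fun s => by
    have := congrArg Complex.im (hexpθ s)
    rwa [Complex.exp_ofReal_mul_I_im, zim'] at this
  have hX' := fun s => (hX s).congr_deriv (hcos s).symm
  have hY' := fun s => (hY s).congr_deriv (hsin s).symm
  refine ⟨fun s => (w s).im + (z' s / z s).arg, ⟨hq, hX', hY', hθc, ?_, ?_, pX, pY⟩, hcos, hsin⟩
  · refine monotone_of_support hX' hY' hθc fun s t => ?_
    rw [hcos, hsin]
    exact hsup s t
  · intro s
    simp only [hturn, pz, pz']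
    ring

/-- The tangent line at a boundary point of a convex body strictly separates the interior
from the complement, and supports the body. -/
lemma det2_tangent_support {Ω : Set Plane} {c : ℝ → Plane} {L : ℝ} (hconv : Convex ℝ Ω)
    (hparam : IsArclengthParam Ω c L) {p : Plane} (hp : p ∈ interior Ω) (s : ℝ) :
    det2 (deriv c s) (p - c s) ≠ 0 ∧
      ∀ t, 0 ≤ det2 (deriv c s) (p - c s) * det2 (deriv c s) (c t - c s) := by
  have hfr : ∀ t, c t ∈ frontier Ω := fun t => hparam.range_eq ▸ Set.mem_range_self t
  obtain ⟨f, hf⟩ := geometric_hahn_banach_open_point hconv.interior isOpen_interior (hfr s).2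
  have hle : ∀ t, f (c t) ≤ f (c s) := fun t => by
    have hcl : c t ∈ closure (interior Ω) := by
      rw [hconv.closure_interior_eq_closure_of_nonempty_interior ⟨p, hp⟩]
      exact (hfr t).1
    exact closure_minimal (fun x hx => (hf x hx).le)
      (isClosed_le f.continuous continuous_const) hcl
  have hd : HasDerivAt c (deriv c s) s :=
    (hparam.contDiff.differentiable one_ne_zero s).hasDerivAt
  have h0 : f (deriv c s) = 0 := IsLocalMax.hasDerivAt_eq_zero (Eventually.of_forall hle)
    (f.hasFDerivAt.comp_hasDerivAt s hd)
  have hunit : deriv c s 0 ^ 2 + deriv c s 1 ^ 2 = 1 := by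
    have := EuclideanSpace.real_norm_sq_eq (deriv c s)
    rw [hparam.unitSpeed, Fin.sum_univ_two] at this
    linarith
  set κ : ℝ := f !₂[-deriv c s 1, deriv c s 0] with hκ
  have hfdet : ∀ v : Plane, f v = κ * det2 (deriv c s) v := fun v => by
    have hv : v = (deriv c s 0 * v 0 + deriv c s 1 * v 1) • deriv c s +
        det2 (deriv c s) v • !₂[-deriv c s 1, deriv c s 0] := by
      ext i
      fin_cases i <;> simp [det2]
      · linear_combination (-v 0) * hunit
      · linear_combination (-v 1) * hunit
    conv_lhs => rw [hv]
    rw [map_add, map_smul, map_smul, h0, smul_zero, zero_add, smul_eq_mul, mul_comm]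
  have hlt := hf p hp
  rw [← sub_neg, ← map_sub, hfdet] at hlt
  refine ⟨fun h => by simp [h] at hlt, fun t => ?_⟩
  have h1 := sub_nonpos.2 (hle t)
  rw [← map_sub, hfdet] at h1
  have h2 : 0 ≤ κ ^ 2 * (det2 (deriv c s) (p - c s) * det2 (deriv c s) (c t - c s)) := by
    have := mul_nonneg_of_nonpos_of_nonpos hlt.le h1
    linarith
  have hκ0 : κ ≠ 0 := fun h => by simp [h] at hlt
  exact nonneg_of_mul_nonneg_right h2 (by positivity)

/-- A curve whose cut-off areas have constant value has bisecting chords. -/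
lemma chord_bisects_of_cutArea_const {c : ℝ → Plane} {L δ : ℝ} (hc : ContDiff ℝ 1 c)
    (harea : ∀ s, cutArea c L δ s = cutArea c L δ 0) (s : ℝ) :
    (c (s + δ * L) 0 - c s 0) * (deriv c (s + δ * L) 1 + deriv c s 1) =
      (c (s + δ * L) 1 - c s 1) * (deriv c (s + δ * L) 0 + deriv c s 0) := by
  have hd : ∀ i s, HasDerivAt (fun s => c s i) (deriv c s i) s := fun i s =>
    (EuclideanSpace.proj (𝕜 := ℝ) i).hasFDerivAt.comp_hasDerivAt s
      (hc.differentiable one_ne_zero s).hasDerivAt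
  have hcc : ∀ i, Continuous fun s => c s i := fun i =>
    continuous_iff_continuousAt.2 fun s => (hd i s).continuousAt
  have hdc : ∀ i, Continuous fun s => deriv c s i := fun i =>
    (EuclideanSpace.proj (𝕜 := ℝ) i).continuous.comp (hc.continuous_deriv le_rfl)
  set q := δ * L with hq
  set g : ℝ → ℝ := fun t => c t 0 * deriv c t 1 - c t 1 * deriv c t 0 with hg
  have hgc : Continuous g := ((hcc 0).mul (hdc 1)).sub ((hcc 1).mul (hdc 0))
  have hint : ∀ a b, IntervalIntegrable g MeasureTheory.volume a b :=
    fun a b => hgc.intervalIntegrable a b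
  have hJ : ∀ s, HasDerivAt (fun s => ∫ t in (0 : ℝ)..s, g t) (g s) s := fun s =>
    intervalIntegral.integral_hasDerivAt_right (hint _ _)
      (hgc.stronglyMeasurableAtFilter _ _) hgc.continuousAt
  have hA : ∀ s, cutArea c L δ s = (1 / 2) * ((∫ t in (0 : ℝ)..(s + q), g t) -
      (∫ t in (0 : ℝ)..s, g t) - (c s 0 * (c (s + q) 1 - c s 1) -
        c s 1 * (c (s + q) 0 - c s 0))) := fun s => by
    have hF : ∀ t, HasDerivAt (fun t => (∫ t in (0 : ℝ)..t, g t) -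
        (c s 0 * c t 1 - c s 1 * c t 0)) (det2 (c t - c s) (deriv c t)) t := fun t => by
      refine ((hJ t).sub (((hd 1 t).const_mul (c s 0)).sub
        ((hd 0 t).const_mul (c s 1)))).congr_deriv ?_
      simp only [det2, hg, PiLp.sub_apply]
      ring
    have hFc : Continuous fun t => det2 (c t - c s) (deriv c t) := by
      have := hcc 0; have := hcc 1; have := hdc 0; have := hdc 1
      simp only [det2, PiLp.sub_apply]
      fun_prop
    rw [cutArea, intervalIntegral.integral_eq_sub_of_hasDerivAt (fun t _ => hF t)
      (hFc.intervalIntegrable _ _)]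
    ring
  have hdA : HasDerivAt (cutArea c L δ) ((1 / 2) * (g (s + q) - g s -
      ((deriv c s 0 * (c (s + q) 1 - c s 1) + c s 0 * (deriv c (s + q) 1 - deriv c s 1)) -
        (deriv c s 1 * (c (s + q) 0 - c s 0) +
          c s 1 * (deriv c (s + q) 0 - deriv c s 0))))) s := by
    rw [funext hA]
    exact ((((hJ (s + q)).comp_add_const s q).sub (hJ s)).sub
      (((hd 0 s).mul (((hd 1 (s + q)).comp_add_const s q).sub (hd 1 s))).sub
        ((hd 1 s).mul (((hd 0 (s + q)).comp_add_const s q).sub (hd 0 s))))).const_mul _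
  have h0 := hdA.unique ((hasDerivAt_const s (cutArea c L δ 0)).congr_of_eventuallyEq
    (.of_forall harea))
  simp only [hg] at h0
  linear_combination 2 * h0

/-- Points of the boundary less than a perimeter apart are distinct. -/
lemma IsArclengthParam.ne_of_lt_add {Ω : Set Plane} {c : ℝ → Plane} {L : ℝ}
    (h : IsArclengthParam Ω c L) {s t : ℝ} (hst : s < t) (hts : t < s + L) : c t ≠ c s := by
  intro heq
  have hmod : ∀ x, c (toIcoMod h.hL 0 x) = c x := fun x => h.periodic.sub_zsmul_eq _
  have hm : toIcoMod h.hL 0 s = toIcoMod h.hL 0 t :=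
    h.injOn (toIcoMod_mem_Ico' h.hL s) (toIcoMod_mem_Ico' h.hL t) (by rw [hmod, hmod, heq])
  obtain ⟨n, hn⟩ := (toIcoMod_eq_toIcoMod h.hL).1 hm
  rw [zsmul_eq_mul] at hn
  have hL := h.hL
  have h1 : (0 : ℝ) < n := pos_of_mul_pos_left (by linarith : 0 < (n : ℝ) * L) hL.le
  have h2 : (n : ℝ) < 1 := lt_of_mul_lt_mul_right (by linarith : (n : ℝ) * L < 1 * L) hL.le
  have h3 : 0 < n := by exact_mod_cast h1
  have h4 : n < 1 := by exact_mod_cast h2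
  omega

/-- The orientation of the boundary: an interior point and the whole boundary lie on the same
side, left or right, of every tangent. -/
lemma exists_orientation {Ω : Set Plane} {c : ℝ → Plane} {L : ℝ} (hconv : Convex ℝ Ω)
    (hparam : IsArclengthParam Ω c L) {p : Plane} (hp : p ∈ interior Ω) :
    ∃ σ : ℝ, σ ^ 2 = 1 ∧ (∀ s, 0 < σ * det2 (deriv c s) (p - c s)) ∧
      ∀ s t, 0 ≤ σ * det2 (deriv c s) (c t - c s) := by
  have hsup := det2_tangent_support hconv hparam hp
  have hcont : Continuous fun s => det2 (deriv c s) (p - c s) := by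
    have h1 := hparam.contDiff.continuous
    have h2 := hparam.contDiff.continuous_deriv le_rfl
    unfold det2
    fun_prop
  have hsign : (∀ s, 0 < det2 (deriv c s) (p - c s)) ∨ ∀ s, det2 (deriv c s) (p - c s) < 0 := by
    by_contra! hcon
    obtain ⟨⟨s, hs⟩, t, ht⟩ := hcon
    obtain ⟨u, hu⟩ := mem_range_of_exists_le_of_exists_ge hcont ⟨s, hs⟩ ⟨t, ht⟩
    exact (hsup u).1 hu
  rcases hsign with h | h
  · exact ⟨1, by norm_num, fun s => by simpa using h s, fun s t => by
      simpa using nonneg_of_mul_nonneg_right ((hsup s).2 t) (h s)⟩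
  · refine ⟨-1, by norm_num, fun s => by simpa using h s, fun s t => ?_⟩
    have := nonpos_of_mul_nonneg_right ((hsup s).2 t) (h s)
    linarith

/-- Salkowski-type, density `1/4`: a compact convex plane body
that floats in the archimedean sense in equilibrium in every orientation at
density `δ = 1/4` has circular boundary. -/
theorem floating_quarter_imp_circle
    (Ω : Set Plane) (c : ℝ → Plane) (L : ℝ)
    (hcomp : IsCompact Ω) (hconv : Convex ℝ Ω) (hint : (interior Ω).Nonempty)
    (hparam : IsArclengthParam Ω c L)
    (harea : ∀ s : ℝ, cutArea c L (1 / 4) s = cutArea c L (1 / 4) 0) :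
    ∃ (x₀ : Plane) (r : ℝ), 0 < r ∧ ∀ s : ℝ, ‖c s - x₀‖ = r := by
  obtain ⟨p, hp⟩ := hint
  obtain ⟨σ, hσ, hpos, hsup⟩ := exists_orientation hconv hparam hp
  have hσ0 : σ ≠ 0 := fun h => by norm_num [h] at hσ
  have hL := hparam.hL
  have hd : ∀ i s, HasDerivAt (fun s => c s i) (deriv c s i) s := fun i s =>
    (EuclideanSpace.proj (𝕜 := ℝ) i).hasFDerivAt.comp_hasDerivAt s
      (hparam.contDiff.differentiable one_ne_zero s).hasDerivAt
  have hdc : ∀ i, Continuous fun s => deriv c s i := fun i =>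
    (EuclideanSpace.proj (𝕜 := ℝ) i).continuous.comp (hparam.contDiff.continuous_deriv le_rfl)
  have hunit : ∀ s, deriv c s 0 ^ 2 + deriv c s 1 ^ 2 = 1 := fun s => by
    have := EuclideanSpace.real_norm_sq_eq (deriv c s)
    rw [hparam.unitSpeed, Fin.sum_univ_two] at this
    linarith
  have hper : ∀ s, c (s + 4 * (1 / 4 * L)) = c s := fun s => by
    rw [show s + 4 * (1 / 4 * L) = s + L by ring, hparam.periodic s]
  have hinj : ∀ s t, s < t → t < s + 4 * (1 / 4 * L) → c t 0 = c s 0 →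
      σ * c t 1 ≠ σ * c s 1 := fun s t hst hts h0 h1 => by
    refine hparam.ne_of_lt_add hst (by linarith) (PiLp.ext fun i => ?_)
    fin_cases i
    · exact h0
    · exact mul_left_cancel₀ hσ0 h1
  obtain ⟨θ, hcurve, hcos, hsin⟩ := exists_isConvexCurve (X := fun s => c s 0)
    (Y := fun s => σ * c s 1) (U := fun s => deriv c s 0) (V := fun s => σ * deriv c s 1)
    (q := 1 / 4 * L) (x := p 0) (y := σ * p 1) (by linarith) (hd 0)
    (fun s => (hd 1 s).const_mul σ) (hdc 0) ((hdc 1).const_mul σ)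
    (fun s => by rw [mul_pow, hσ, one_mul, hunit]) (fun s => by simp only [hper])
    (fun s => by simp only [hper]) hinj
    (fun s => by have := hpos s; simp only [det2, PiLp.sub_apply] at this; linarith)
    (fun s t => by have := hsup s t; simp only [det2, PiLp.sub_apply] at this; linarith)
  have hbis : HasBisectingChords (fun s => c s 0) (fun s => σ * c s 1) θ (1 / 4 * L) :=
    fun s => by
    have := chord_bisects_of_cutArea_const hparam.contDiff harea s
    simp only [hcos, hsin]
    linear_combination σ * this
  obtain ⟨x, y, r, hr, hcircle⟩ := hcurve.exists_circle hbis fun s => by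
    by_contra! hcon
    obtain ⟨h0, h1⟩ := eq_zero_of_sq_add_sq_eq_zero (hcon.antisymm (by positivity))
    exact hinj s (s + 2 * (1 / 4 * L)) (by linarith) (by linarith) (sub_eq_zero.1 h0)
      (sub_eq_zero.1 h1)
  refine ⟨!₂[x, σ * y], r, hr, fun s => ?_⟩
  rw [← sq_eq_sq₀ (norm_nonneg _) hr.le, EuclideanSpace.real_norm_sq_eq, Fin.sum_univ_two,
    ← hcircle s]
  simp
  linear_combination (y ^ 2 - c s 1 ^ 2) * hσ
end
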